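/- Fix an integer N ≥ 2, β > 0 and a, b > 0. Let c_1,…,c_{2N−1} be independent random variables with c_{2n−1} distributed as the Beta distribution with parameters (β(N−n)/2 + a, β(N−n)/2 + b) for 1 ≤ n ≤ N, and c_{2n} distributed as the Beta distribution with parameters (β(N−n)/2, β(N−n−1)/2 + a + b) for 1 ≤ n ≤ N−1. Define a_1 = c_1, a_n = (1−c_{2n−3})c_{2n−2} + (1−c_{2n−2})c_{2n−1} for 2 ≤ n ≤ N, b_1 = c_1(1−c_1)c_2, and b_n = (1−c_{2n−2})c_{2n−1}(1−c_{2n−1})c_{2n} for 2 ≤ n ≤ N−1. Then the joint law of the decreasingly ordered eigenvalues (x_1 > … > x_N) of the random Jacobi matrix J_{a,b} is the probability measure on ℝ^N proportional to |Δ(x_1,…,x_N)|^β ∏_{n=1}^N x_n^{a−1}(1−x_n)^{b−1} restricted to the set {x ∈ (0,1)^N : x_1 > … > x_N}. Equivalently, the eigenvalues of J_{a,b} form the Jacobi β-ensemble with potential V(x) = −[(a−1)log(x) + (b−1)log(1−x)] on (0,1). -/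

import Mathlib

open MeasureTheory ProbabilityTheory Matrix Finset Real
open scoped ENNReal NNReal

noncomputable section

/-- The symmetric tridiagonal (Jacobi) matrix with diagonal `a` and
off-diagonal entries `√(b n)`. -/
def jacobiMatrix {N : ℕ} (a : Fin N → ℝ) (b : Fin (N - 1) → ℝ) :
    Matrix (Fin N) (Fin N) ℝ :=
  Matrix.of fun i j =>
    if i = j then a i
    else if h : (i : ℕ) + 1 = (j : ℕ) then
      Real.sqrt (b ⟨i, by have := j.isLt; omega⟩)
    else if h' : (j : ℕ) + 1 = (i : ℕ) then
      Real.sqrt (b ⟨j, by have := i.isLt; omega⟩)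
    else 0

lemma jacobiMatrix_isHermitian {N : ℕ} (a : Fin N → ℝ) (b : Fin (N - 1) → ℝ) :
    (jacobiMatrix a b).IsHermitian := by
  unfold Matrix.IsHermitian
  ext i j
  simp only [jacobiMatrix, Matrix.conjTranspose_apply, Matrix.of_apply, star_trivial]
  by_cases hij : i = j
  · subst hij; simp
  · have hji : j ≠ i := fun h => hij h.symm
    rw [if_neg hji, if_neg hij]
    by_cases h1 : (j : ℕ) + 1 = (i : ℕ)
    · have h2 : ¬((i : ℕ) + 1 = (j : ℕ)) := by omega
      rw [dif_pos h1, dif_neg h2, dif_pos h1]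
    · by_cases h2 : (i : ℕ) + 1 = (j : ℕ)
      · rw [dif_neg h1, dif_pos h2, dif_pos h2]
      · rw [dif_neg h1, dif_neg h2, dif_neg h2, dif_neg h1]

/-- Reordering of a finite tuple in decreasing order. -/
def sortDesc {N : ℕ} (v : Fin N → ℝ) : Fin N → ℝ :=
  fun i => v (Tuple.sort v (Fin.rev i))

/-- The eigenvalues of the Jacobi matrix `J_{a,b}`, in decreasing order. -/
def jacobiEigs {N : ℕ} (a : Fin N → ℝ) (b : Fin (N - 1) → ℝ) : Fin N → ℝ :=
  sortDesc (jacobiMatrix_isHermitian a b).eigenvalues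

/-- The squared first coordinates of unit eigenvectors of the Jacobi matrix `J_{a,b}`,
indexed compatibly with `jacobiEigs` (decreasing eigenvalue order):
`jacobiWeights hN a b i` is the squared first coordinate of a unit eigenvector
associated with the eigenvalue `jacobiEigs a b i`. -/
def jacobiWeights {N : ℕ} (hN : 0 < N) (a : Fin N → ℝ) (b : Fin (N - 1) → ℝ) :
    Fin N → ℝ :=
  fun i =>
    ((jacobiMatrix_isHermitian a b).eigenvectorBasis
        (Tuple.sort (jacobiMatrix_isHermitian a b).eigenvalues (Fin.rev i)) ⟨0, hN⟩) ^ 2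

/-- The spectral map: Jacobi data `(a, b)` is sent to the decreasingly ordered
eigenvalues together with the first `N - 1` spectral weights. -/
def spectralMap {N : ℕ} (hN : 0 < N) (a : Fin N → ℝ) (b : Fin (N - 1) → ℝ) :
    (Fin N → ℝ) × (Fin (N - 1) → ℝ) :=
  ⟨jacobiEigs a b, fun i => jacobiWeights hN a b ⟨i, by have := i.isLt; omega⟩⟩

/-- The Vandermonde product `∏_{i<j} (x j - x i)`. -/
def vdm {N : ℕ} (x : Fin N → ℝ) : ℝ :=
  ∏ i : Fin N, ∏ j ∈ Finset.Ioi i, (x j - x i)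

/-- The open chamber of decreasing vectors `x 0 > x 1 > … `. -/
def chamber (N : ℕ) : Set (Fin N → ℝ) := {x | ∀ i j : Fin N, i < j → x j < x i}

/-- The open simplex of positive weights with sum `< 1`. -/
def openSimplex (N : ℕ) : Set (Fin (N - 1) → ℝ) :=
  {w | (∀ i, 0 < w i) ∧ ∑ i, w i < 1}

/-- Extension of `N - 1` weights by the last weight `1 - ∑ w`. -/
def wExt {N : ℕ} (w : Fin (N - 1) → ℝ) : Fin N → ℝ :=
  fun n => if h : (n : ℕ) < N - 1 then w ⟨n, h⟩ else 1 - ∑ i, w i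

/-- The first `N` coordinates of a vector of length `2N - 1`. -/
def xPart {N : ℕ} (p : Fin (2 * N - 1) → ℝ) : Fin N → ℝ :=
  fun i => p ⟨i, by have := i.isLt; omega⟩

/-- The last `N - 1` coordinates of a vector of length `2N - 1`. -/
def wPart {N : ℕ} (p : Fin (2 * N - 1) → ℝ) : Fin (N - 1) → ℝ :=
  fun i => p ⟨N + i, by have := i.isLt; omega⟩

/-- The diagonal coefficients `a` built from the parameters `ξ`:
`a 1 = ξ 1`, `a n = ξ (2n-2) + ξ (2n-1)` (in one-based notation). -/
def xiToA {N : ℕ} (ξ : Fin (2 * N - 1) → ℝ) : Fin N → ℝ :=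
  fun n =>
    if h : (n : ℕ) = 0 then ξ ⟨0, by have := n.isLt; omega⟩
    else ξ ⟨2 * (n : ℕ) - 1, by have := n.isLt; omega⟩ +
      ξ ⟨2 * (n : ℕ), by have := n.isLt; omega⟩

/-- The off-diagonal coefficients `b` built from the parameters `ξ`:
`b n = ξ (2n-1) * ξ (2n)` (in one-based notation). -/
def xiToB {N : ℕ} (ξ : Fin (2 * N - 1) → ℝ) : Fin (N - 1) → ℝ :=
  fun n => ξ ⟨2 * (n : ℕ), by have := n.isLt; omega⟩ *
    ξ ⟨2 * (n : ℕ) + 1, by have := n.isLt; omega⟩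

/-- The chain-sequence parameters `ξ` built from canonical moments `c`:
`ξ 1 = c 1` and `ξ n = (1 - c (n-1)) * c n` (in one-based notation). -/
def cToXi {N : ℕ} (c : Fin (2 * N - 1) → ℝ) : Fin (2 * N - 1) → ℝ :=
  fun k =>
    if (k : ℕ) = 0 then c k
    else (1 - c ⟨(k : ℕ) - 1, by have := k.isLt; omega⟩) * c k

/-- The lower bidiagonal matrix `Ξ` with diagonal `√ξ 1, √ξ 3, …` and
subdiagonal `√ξ 2, √ξ 4, …` (in one-based notation). -/
def bidiag {N : ℕ} (ξ : Fin (2 * N - 1) → ℝ) : Matrix (Fin N) (Fin N) ℝ :=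
  Matrix.of fun i j =>
    if i = j then Real.sqrt (ξ ⟨2 * (i : ℕ), by have := i.isLt; omega⟩)
    else if h : (j : ℕ) + 1 = (i : ℕ) then
      Real.sqrt (ξ ⟨2 * (j : ℕ) + 1, by have := i.isLt; omega⟩)
    else 0

lemma mul_transpose_isHermitian {N : ℕ} (A : Matrix (Fin N) (Fin N) ℝ) :
    (A * Aᵀ).IsHermitian := by
  unfold Matrix.IsHermitian
  ext i j
  simp [Matrix.mul_apply, Matrix.conjTranspose_apply, Matrix.transpose_apply, mul_comm]

/-- The Beta distribution with parameters `α, γ`. -/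
def betaM (α γ : ℝ) : Measure ℝ :=
  volume.withDensity fun x =>
    ENNReal.ofReal ((Set.Ioo (0 : ℝ) 1).indicator
      (fun x => (Real.Gamma (α + γ) / (Real.Gamma α * Real.Gamma γ)) *
        x ^ (α - 1) * (1 - x) ^ (γ - 1)) x)

/-! ### Part A: weighted walks and the moment map in terms of canonical moments -/

/-- Extension of a finite tuple by zero. -/
def ext0 {m : ℕ} (c : Fin m → ℝ) (k : ℕ) : ℝ := if h : k < m then c ⟨k, h⟩ else 0

lemma ext0_lt {m : ℕ} (c : Fin m → ℝ) {k : ℕ} (h : k < m) : ext0 c k = c ⟨k, h⟩ := by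
  simp [ext0, h]

lemma ext0_ge {m : ℕ} (c : Fin m → ℝ) {k : ℕ} (h : m ≤ k) : ext0 c k = 0 := by
  simp [ext0, h]

lemma ext0_fin {m : ℕ} (c : Fin m → ℝ) (k : Fin m) : ext0 c k = c k := by
  simp [ext0]

/-- Chain sequence, indexed by `ℕ`. -/
def chainSeq (c : ℕ → ℝ) (k : ℕ) : ℝ := if k = 0 then c 0 else (1 - c (k - 1)) * c k

lemma ext0_cToXi {N : ℕ} (c : Fin (2 * N - 1) → ℝ) (k : ℕ) :
    ext0 (cToXi c) k = chainSeq (ext0 c) k := by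
  unfold chainSeq
  by_cases h : k < 2 * N - 1
  · rw [ext0_lt _ h]
    unfold cToXi
    by_cases h0 : k = 0
    · subst h0; simp [ext0, h]
    · have h1 : k - 1 < 2 * N - 1 := by omega
      simp [h0, ext0_lt c h, ext0_lt c h1]
  · rw [ext0_ge _ (by omega), ext0_ge c (k := k) (by omega)]
    by_cases h0 : k = 0
    · subst h0; simp [ext0_ge c (k := 0) (by omega)]
    · simp [h0]

/-- Weighted walk counts: up-steps have weight `1`, the down-step from `j+1` to `j`
has weight `ξ j`. -/
def walk (ξ : ℕ → ℝ) : ℕ → ℕ → ℝ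
  | 0, j => if j = 0 then 1 else 0
  | s + 1, 0 => ξ 0 * walk ξ s 1
  | s + 1, j + 1 => walk ξ s j + ξ (j + 1) * walk ξ s (j + 2)

lemma walk_zero_of_lt (ξ : ℕ → ℝ) : ∀ s j, s < j → walk ξ s j = 0 := by
  intro s
  induction s with
  | zero => intro j hj; simp [walk]; omega
  | succ s ih =>
    intro j hj
    obtain _ | j := j
    · omega
    · simp [walk, ih j (by omega), ih (j + 2) (by omega)]

lemma walk_diag (ξ : ℕ → ℝ) : ∀ s, walk ξ s s = 1 := by
  intro s
  induction s with
  | zero => simp [walk]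
  | succ s ih => simp [walk, ih, walk_zero_of_lt ξ s (s + 2) (by omega)]

lemma walk_congr (ξ ξ' : ℕ → ℝ) (h : ℕ) (heq : ∀ i < h, ξ' i = ξ i) :
    ∀ s j, s + j ≤ 2 * h + 1 → walk ξ' s j = walk ξ s j := by
  intro s
  induction s with
  | zero => intro j _; simp [walk]
  | succ s ih =>
    intro j hj
    have key : ∀ j, s + 1 + j ≤ 2 * h + 1 → ξ' j * walk ξ' s (j + 1) = ξ j * walk ξ s (j + 1) := by
      intro j hj
      by_cases hjh : j < h
      · rw [heq j hjh, ih (j + 1) (by omega)]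
      · rw [walk_zero_of_lt _ _ _ (by omega), walk_zero_of_lt _ _ _ (by omega)]; simp
    obtain _ | j := j
    · simpa [walk] using key 0 hj
    · simp only [walk]
      rw [ih j (by omega), key (j + 1) (by omega)]

lemma walk_diff (ξ ξ' : ℕ → ℝ) (h : ℕ) (heq : ∀ i < h, ξ' i = ξ i) :
    ∀ s j, s + j = 2 * h + 2 → j ≤ h →
      walk ξ' s j - walk ξ s j = (ξ' h - ξ h) * ∏ i ∈ Finset.Ico j h, ξ i := by
  intro s
  induction s with
  | zero => intro j hj hj'; omega
  | succ s ih =>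
    intro j hj hjh
    have key : ξ' j * walk ξ' s (j + 1) - ξ j * walk ξ s (j + 1)
        = (ξ' h - ξ h) * ∏ i ∈ Finset.Ico j h, ξ i := by
      rcases hjh.lt_or_eq with hlt | rfl
      · rw [heq j hlt, ← mul_sub, ih (j + 1) (by omega) (by omega),
          Finset.prod_eq_prod_Ico_succ_bot hlt]
        ring
      · have : s = j + 1 := by omega
        subst this
        simp [walk_diag]
    obtain _ | j := j
    · simpa [walk] using key
    · simp only [walk]
      rw [walk_congr ξ ξ' h heq s j (by omega)]
      linarith [key]

/-- The moment map in canonical-moment coordinates. -/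
def momF {m : ℕ} (c : Fin m → ℝ) : Fin m → ℝ :=
  fun k => walk (chainSeq (ext0 c)) (2 * (k : ℕ) + 2) 0

/-- The factor `1 - c_{k-1}` (or `1` if `k = 0`). -/
def prevC (c : ℕ → ℝ) (k : ℕ) : ℝ := if k = 0 then 1 else 1 - c (k - 1)

lemma chainSeq_eq (c : ℕ → ℝ) (k : ℕ) : chainSeq c k = prevC c k * c k := by
  unfold chainSeq prevC
  split_ifs with h
  · simp [h]
  · rfl

lemma momF_diff {m : ℕ} (c c' : Fin m → ℝ) (k : Fin m) (heq : ∀ i < k, c' i = c i) :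
    momF c' k - momF c k = (c' k - c k) *
      (prevC (ext0 c) k * ∏ i ∈ Finset.range k, chainSeq (ext0 c) i) := by
  have h1 : ∀ i < (k : ℕ), ext0 c' i = ext0 c i := by
    intro i hi
    have : i < m := by omega
    rw [ext0_lt _ this, ext0_lt _ this, heq _ (by exact hi)]
  have hp : ∀ i ≤ (k : ℕ), prevC (ext0 c') i = prevC (ext0 c) i := by
    intro i hi
    unfold prevC
    split_ifs with h
    · rfl
    · rw [h1 _ (by omega)]
  have h2 : ∀ i < (k : ℕ), chainSeq (ext0 c') i = chainSeq (ext0 c) i := by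
    intro i hi
    rw [chainSeq_eq, chainSeq_eq, hp i hi.le, h1 i hi]
  unfold momF
  rw [walk_diff _ _ k h2 _ 0 (by omega) (by omega), chainSeq_eq, chainSeq_eq, hp _ le_rfl,
    ext0_fin, ext0_fin, Finset.range_eq_Ico]
  ring

lemma contDiff_ext0 {m : ℕ} (k : ℕ) : ContDiff ℝ 1 (fun c : Fin m → ℝ => ext0 c k) := by
  unfold ext0
  by_cases h : k < m
  · simp only [h, dif_pos]; fun_prop
  · simp only [h, dif_neg, not_false_eq_true]; fun_prop

lemma contDiff_chainSeq {m : ℕ} (k : ℕ) :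
    ContDiff ℝ 1 (fun c : Fin m → ℝ => chainSeq (ext0 c) k) := by
  unfold chainSeq
  by_cases h : k = 0
  · simp only [h, if_true]; exact contDiff_ext0 0
  · simp only [h, if_false]
    exact (contDiff_const.sub (contDiff_ext0 _)).mul (contDiff_ext0 _)

lemma contDiff_walk {m : ℕ} (s : ℕ) : ∀ j,
    ContDiff ℝ 1 (fun c : Fin m → ℝ => walk (chainSeq (ext0 c)) s j) := by
  induction s with
  | zero => intro j; simp only [walk]; fun_prop
  | succ s ih =>
    intro j
    obtain _ | j := j
    · simp only [walk]; exact (contDiff_chainSeq 0).mul (ih 1)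
    · simp only [walk]; exact (ih j).add ((contDiff_chainSeq _).mul (ih _))

lemma contDiff_momF {m : ℕ} : ContDiff ℝ 1 (momF : (Fin m → ℝ) → (Fin m → ℝ)) :=
  contDiff_pi.2 fun _ => contDiff_walk _ 0

/-- Absolute value of the Jacobian of `momF`. -/
def jacF {m : ℕ} (c : Fin m → ℝ) : ℝ :=
  ∏ k : Fin m, (prevC (ext0 c) k * ∏ i ∈ Finset.range k, chainSeq (ext0 c) i)

lemma fderiv_momF_apply {m : ℕ} (c : Fin m → ℝ) (k j : Fin m) :
    HasDerivAt (fun t : ℝ => momF (c + t • Pi.single j (1 : ℝ)) k)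
      (fderiv ℝ momF c (Pi.single j 1) k) 0 := by
  have h1 : HasFDerivAt momF (fderiv ℝ (momF (m := m)) c) (c + (0 : ℝ) • Pi.single j (1 : ℝ)) := by
    simpa using (contDiff_momF.differentiable (by norm_num) c).hasFDerivAt
  have h2 : HasDerivAt (fun t : ℝ => c + t • (Pi.single j (1 : ℝ) : Fin m → ℝ))
      (Pi.single j (1 : ℝ)) 0 := by
    simpa using ((hasDerivAt_id (0 : ℝ)).smul_const (Pi.single j (1 : ℝ) : Fin m → ℝ)).const_add c
  exact (hasDerivAt_pi.1 (h1.comp_hasDerivAt (0 : ℝ) h2)) k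

lemma det_fderiv_momF {m : ℕ} (c : Fin m → ℝ) : (fderiv ℝ momF c).det = jacF c := by
  have h0 : (fderiv ℝ momF c).det =
      (LinearMap.toMatrix' (fderiv ℝ momF c : (Fin m → ℝ) →ₗ[ℝ] (Fin m → ℝ))).det := by
    rw [LinearMap.det_toMatrix']
  have hent : ∀ k j : Fin m, k ≤ j →
      (LinearMap.toMatrix' (fderiv ℝ momF c : (Fin m → ℝ) →ₗ[ℝ] (Fin m → ℝ))) k j =
      if k = j then (prevC (ext0 c) k * ∏ i ∈ Finset.range k, chainSeq (ext0 c) i) else 0 := by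
    intro k j hkj
    rw [LinearMap.toMatrix'_apply]
    have h1 := fderiv_momF_apply c k j
    have h2 : (fun t : ℝ => momF (c + t • Pi.single j (1 : ℝ)) k) = fun t => momF c k +
        t * (if k = j then (prevC (ext0 c) k * ∏ i ∈ Finset.range k, chainSeq (ext0 c) i) else 0) := by
      funext t
      have := momF_diff c (c + t • Pi.single j (1 : ℝ)) k (by
        intro i hi
        have : i ≠ j := (hi.trans_le hkj).ne
        simp [this])
      split_ifs with hk
      · subst hk
        simp at this
        simp only [← this]; ring
      · simp [hk] at this
        linarith
    rw [h2] at h1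
    have h3 := ((hasDerivAt_id (0 : ℝ)).mul_const (if k = j then (prevC (ext0 c) k * ∏ i ∈ Finset.range k, chainSeq (ext0 c) i) else 0)).const_add (momF c k)
    have := h1.unique h3
    have h4 : (fun j' => if j' = j then (1 : ℝ) else 0) = Pi.single j 1 := by
      ext i; simp [Pi.single_apply]
    simpa [h4] using this
  rw [h0, Matrix.det_of_lowerTriangular]
  · unfold jacF
    refine Finset.prod_congr rfl fun k _ => ?_
    rw [hent k k le_rfl, if_pos rfl]
  · intro i j hij
    have hij' : i < j := hij
    rw [hent i j hij'.le, if_neg hij'.ne]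

/-- The open cube. -/
def cube (m : ℕ) : Set (Fin m → ℝ) := {c | ∀ i, c i ∈ Set.Ioo (0 : ℝ) 1}

lemma cube_ext {m : ℕ} {c : Fin m → ℝ} (hc : c ∈ cube m) {k : ℕ} (hk : k < m) :
    0 < ext0 c k ∧ ext0 c k < 1 := by
  rw [ext0_lt _ hk]; exact hc _

lemma prevC_pos {m : ℕ} {c : Fin m → ℝ} (hc : c ∈ cube m) {k : ℕ} (hk : k ≤ m) :
    0 < prevC (ext0 c) k := by
  unfold prevC
  split_ifs
  · norm_num
  · linarith [(cube_ext hc (k := k - 1) (by omega)).2]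

lemma chainSeq_pos {m : ℕ} {c : Fin m → ℝ} (hc : c ∈ cube m) {k : ℕ} (hk : k < m) :
    0 < chainSeq (ext0 c) k := by
  rw [chainSeq_eq]
  exact mul_pos (prevC_pos hc hk.le) (cube_ext hc hk).1

lemma facF_pos {m : ℕ} {c : Fin m → ℝ} (hc : c ∈ cube m) (k : Fin m) :
    0 < prevC (ext0 c) k * ∏ i ∈ Finset.range k, chainSeq (ext0 c) i :=
  mul_pos (prevC_pos hc k.2.le) (Finset.prod_pos fun i hi => chainSeq_pos hc (by
    have := Finset.mem_range.1 hi; omega))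

lemma jacF_pos {m : ℕ} {c : Fin m → ℝ} (hc : c ∈ cube m) : 0 < jacF c :=
  Finset.prod_pos fun k _ => facF_pos hc k

lemma injOn_momF {m : ℕ} : Set.InjOn (momF : (Fin m → ℝ) → (Fin m → ℝ)) (cube m) := by
  intro c hc c' _ h
  have : ∀ n, ∀ k : Fin m, (k : ℕ) = n → c' k = c k := by
    intro n
    induction n using Nat.strong_induction_on with
    | _ n ih =>
      intro k hk
      have := momF_diff c c' k (fun i hi => ih i (by rw [← hk]; exact hi) i rfl)
      rw [h, sub_self] at this
      have h2 := mul_eq_zero.1 this.symm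
      rcases h2 with h2 | h2
      · linarith
      · exact absurd h2 (facF_pos hc k).ne'
  ext k
  exact (this k k rfl).symm

lemma isOpen_cube (m : ℕ) : IsOpen (cube m) := by
  have : cube m = Set.pi Set.univ fun _ => Set.Ioo (0 : ℝ) 1 := by ext; simp [cube]
  rw [this]
  exact isOpen_set_pi Set.finite_univ fun _ _ => isOpen_Ioo

lemma isOpen_momF_image (m : ℕ) : IsOpen (momF '' cube m) := by
  rw [isOpen_iff_mem_nhds]
  rintro _ ⟨c, hc, rfl⟩
  have h1 : HasStrictFDerivAt momF (fderiv ℝ (momF (m := m)) c) c :=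
    contDiff_momF.contDiffAt.hasStrictFDerivAt (by norm_num)
  have h2 : (fderiv ℝ momF c).range = ⊤ := by
    rw [LinearMap.range_eq_top]
    have hu : IsUnit (LinearMap.det (fderiv ℝ momF c : (Fin m → ℝ) →ₗ[ℝ] (Fin m → ℝ))) := by
      have := det_fderiv_momF c
      rw [isUnit_iff_ne_zero]
      rw [ContinuousLinearMap.det] at this
      rw [this]; exact (jacF_pos hc).ne'
    have := (LinearMap.equivOfIsUnitDet hu).surjective
    intro y
    obtain ⟨x, hx⟩ := this y
    exact ⟨x, by simpa using hx⟩
  rw [← h1.map_nhds_eq_of_surj h2]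
  exact Filter.image_mem_map ((isOpen_cube m).mem_nhds hc)

/-! ### Part B: the moment map in spectral coordinates -/

/-- Atoms of the spectral measure, read off interleaved coordinates. -/
def xs {N : ℕ} (p : Fin (2 * N - 1) → ℝ) : Fin N → ℝ := fun i => ext0 p (2 * i)

/-- Weights of the spectral measure. -/
def ws {N : ℕ} (p : Fin (2 * N - 1) → ℝ) : Fin N → ℝ := fun i =>
  if (i : ℕ) = 0 then 1 - ∑ l ∈ Finset.range (N - 1), ext0 p (2 * l + 1) else ext0 p (2 * i - 1)

/-- Linear part of `ws`. -/
def dws {N : ℕ} (p : Fin (2 * N - 1) → ℝ) : Fin N → ℝ := fun i =>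
  if (i : ℕ) = 0 then - ∑ l ∈ Finset.range (N - 1), ext0 p (2 * l + 1) else ext0 p (2 * i - 1)

/-- Integral of a polynomial against the spectral measure. -/
def polInt {N : ℕ} (q : Polynomial ℝ) (p : Fin (2 * N - 1) → ℝ) : ℝ :=
  ∑ i : Fin N, ws p i * q.eval (xs p i)

/-- The moment map in spectral coordinates. -/
def momG {N : ℕ} (p : Fin (2 * N - 1) → ℝ) : Fin (2 * N - 1) → ℝ :=
  fun k => polInt (Polynomial.X ^ ((k : ℕ) + 1)) p

lemma ext0_add {m : ℕ} (p v : Fin m → ℝ) (t : ℝ) (k : ℕ) :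
    ext0 (p + t • v) k = ext0 p k + t * ext0 v k := by
  unfold ext0; split_ifs <;> simp

lemma xs_add {N : ℕ} (p v : Fin (2 * N - 1) → ℝ) (t : ℝ) (i : Fin N) :
    xs (p + t • v) i = xs p i + t * xs v i := ext0_add _ _ _ _

lemma ws_add {N : ℕ} (p v : Fin (2 * N - 1) → ℝ) (t : ℝ) (i : Fin N) :
    ws (p + t • v) i = ws p i + t * dws v i := by
  unfold ws dws
  split_ifs
  · simp only [ext0_add, Finset.sum_add_distrib, ← Finset.mul_sum]; ring
  · exact ext0_add _ _ _ _

lemma sum_fin_interleave {N : ℕ} (hN : 0 < N) (g : ℕ → ℝ) (a : ℝ) :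
    ∑ i : Fin N, (if (i : ℕ) = 0 then a else g (2 * i - 1)) =
      a + ∑ l ∈ Finset.range (N - 1), g (2 * l + 1) := by
  obtain ⟨n, rfl⟩ : ∃ n, N = n + 1 := ⟨N - 1, by omega⟩
  rw [Fin.sum_univ_succ]
  simp only [Fin.val_zero, if_true, Fin.val_succ, Nat.add_one_ne_zero, if_false,
    Nat.add_sub_cancel]
  rw [Finset.sum_range]
  rfl

lemma sum_ws {N : ℕ} (hN : 0 < N) (p : Fin (2 * N - 1) → ℝ) : ∑ i, ws p i = 1 := by
  unfold ws; rw [sum_fin_interleave hN]; ring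

lemma sum_dws {N : ℕ} (hN : 0 < N) (p : Fin (2 * N - 1) → ℝ) : ∑ i, dws p i = 0 := by
  unfold dws; rw [sum_fin_interleave hN]; ring

/-- Differential of `polInt`, linear in the polynomial. -/
def dInt {N : ℕ} (p v : Fin (2 * N - 1) → ℝ) : Polynomial ℝ →ₗ[ℝ] ℝ :=
  ∑ i : Fin N, (dws v i • (Polynomial.leval (xs p i)) +
    (ws p i * xs v i) • ((Polynomial.leval (xs p i)).comp Polynomial.derivative))

lemma dInt_apply {N : ℕ} (p v : Fin (2 * N - 1) → ℝ) (q : Polynomial ℝ) :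
    dInt p v q = ∑ i : Fin N, (dws v i * q.eval (xs p i) +
      ws p i * xs v i * q.derivative.eval (xs p i)) := by
  simp [dInt, Polynomial.leval]

lemma hasDerivAt_polInt {N : ℕ} (q : Polynomial ℝ) (p v : Fin (2 * N - 1) → ℝ) :
    HasDerivAt (fun t : ℝ => polInt q (p + t • v)) (dInt p v q) 0 := by
  rw [dInt_apply]
  unfold polInt
  simp only [ws_add, xs_add]
  refine HasDerivAt.fun_sum fun i _ => ?_
  have h1 : HasDerivAt (fun t : ℝ => ws p i + t * dws v i) (dws v i) 0 := by
    simpa using ((hasDerivAt_id (0 : ℝ)).mul_const (dws v i)).const_add (ws p i)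
  have h2 : HasDerivAt (fun t : ℝ => xs p i + t * xs v i) (xs v i) 0 := by
    simpa using ((hasDerivAt_id (0 : ℝ)).mul_const (xs v i)).const_add (xs p i)
  have h3 : HasDerivAt (fun t : ℝ => q.eval (xs p i + t * xs v i))
      (q.derivative.eval (xs p i + 0 * xs v i) * xs v i) 0 :=
    HasDerivAt.comp (h₂ := fun y => q.eval y) (0 : ℝ) (q.hasDerivAt (xs p i + 0 * xs v i)) h2
  have := h1.mul h3
  refine this.congr_deriv ?_
  simp only [zero_mul, add_zero]; ring

lemma contDiff_xs {N : ℕ} (i : Fin N) : ContDiff ℝ 1 (fun p : Fin (2 * N - 1) → ℝ => xs p i) :=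
  contDiff_ext0 _

lemma contDiff_ws {N : ℕ} (i : Fin N) : ContDiff ℝ 1 (fun p : Fin (2 * N - 1) → ℝ => ws p i) := by
  unfold ws
  split_ifs
  · exact contDiff_const.sub (ContDiff.sum fun _ _ => contDiff_ext0 _)
  · exact contDiff_ext0 _

lemma contDiff_momG {N : ℕ} :
    ContDiff ℝ 1 (momG : (Fin (2 * N - 1) → ℝ) → (Fin (2 * N - 1) → ℝ)) := by
  refine contDiff_pi.2 fun k => ?_
  unfold momG polInt
  refine ContDiff.sum fun i _ => ?_
  simp only [Polynomial.eval_pow, Polynomial.eval_X]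
  exact (contDiff_ws i).mul ((contDiff_xs i).pow _)

lemma fderiv_momG_apply {N : ℕ} (p : Fin (2 * N - 1) → ℝ) (k j : Fin (2 * N - 1)) :
    fderiv ℝ momG p (Pi.single j 1) k =
      dInt p (Pi.single j 1) (Polynomial.X ^ ((k : ℕ) + 1)) := by
  have h1 : HasFDerivAt momG (fderiv ℝ (momG (N := N)) p) (p + (0 : ℝ) • Pi.single j (1 : ℝ)) := by
    simpa using (contDiff_momG.differentiable (by norm_num) p).hasFDerivAt
  have h2 : HasDerivAt (fun t : ℝ => p + t • (Pi.single j (1 : ℝ) : Fin (2 * N - 1) → ℝ))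
      (Pi.single j (1 : ℝ)) 0 := by
    simpa using ((hasDerivAt_id (0 : ℝ)).smul_const
      (Pi.single j (1 : ℝ) : Fin (2 * N - 1) → ℝ)).const_add p
  have h3 := (hasDerivAt_pi.1 (h1.comp_hasDerivAt (0 : ℝ) h2)) k
  exact h3.unique (hasDerivAt_polInt _ p _)

/-- Newton-type basis with doubled nodes. -/
def newt {m : ℕ} (p : Fin m → ℝ) (k : ℕ) : Polynomial ℝ :=
  ∏ t ∈ Finset.range k, (Polynomial.X - Polynomial.C (ext0 p (2 * (t / 2))))

lemma newt_monic {m : ℕ} (p : Fin m → ℝ) (k : ℕ) : (newt p k).Monic :=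
  Polynomial.monic_prod_of_monic _ _ fun _ _ => Polynomial.monic_X_sub_C _

lemma newt_natDegree {m : ℕ} (p : Fin m → ℝ) (k : ℕ) : (newt p k).natDegree = k := by
  unfold newt
  rw [Polynomial.natDegree_prod_of_monic _ _ fun _ _ => Polynomial.monic_X_sub_C _]
  simp

lemma newt_succ {m : ℕ} (p : Fin m → ℝ) (k : ℕ) :
    newt p (k + 1) = newt p k * (Polynomial.X - Polynomial.C (ext0 p (2 * (k / 2)))) := by
  unfold newt; rw [Finset.prod_range_succ]

lemma newt_dvd {m : ℕ} (p : Fin m → ℝ) {k l : ℕ} (h : k ≤ l) : newt p k ∣ newt p l :=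
  Finset.prod_dvd_prod_of_subset _ _ _ (Finset.range_subset_range.2 h)

lemma newt_eval_zero {m : ℕ} (p : Fin m → ℝ) {k i : ℕ} (h : 2 * i < k) :
    (newt p k).eval (ext0 p (2 * i)) = 0 := by
  obtain ⟨r, hr⟩ := newt_dvd p (show 2 * i + 1 ≤ k from h)
  rw [hr, newt_succ]
  simp

lemma newt_deriv_eval_zero {m : ℕ} (p : Fin m → ℝ) {k i : ℕ} (h : 2 * i + 1 < k) :
    (newt p k).derivative.eval (ext0 p (2 * i)) = 0 := by
  obtain ⟨r, hr⟩ := newt_dvd p (show 2 * i + 1 + 1 ≤ k from h)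
  rw [hr, newt_succ, newt_succ]
  have : (2 * i + 1) / 2 = i := by omega
  simp [this]

lemma newt_deriv_eval {m : ℕ} (p : Fin m → ℝ) (i : ℕ) :
    (newt p (2 * i + 1)).derivative.eval (ext0 p (2 * i)) = (newt p (2 * i)).eval (ext0 p (2 * i)) := by
  rw [newt_succ]; simp

lemma newt_eval {m : ℕ} (p : Fin m → ℝ) (i : ℕ) (y : ℝ) :
    (newt p (2 * i)).eval y = ∏ l ∈ Finset.range i, (y - ext0 p (2 * l)) ^ 2 := by
  induction i with
  | zero => simp [newt]
  | succ i ih =>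
    have : (2 * i + 1) / 2 = i := by omega
    rw [show 2 * (i + 1) = 2 * i + 1 + 1 by ring, newt_succ, newt_succ, Finset.prod_range_succ, ← ih]
    simp [this]; ring

lemma dInt_even {N : ℕ} (p : Fin (2 * N - 1) → ℝ) (j : Fin (2 * N - 1)) (i : Fin N)
    (hj : (j : ℕ) = 2 * i) (q : Polynomial ℝ) :
    dInt p (Pi.single j 1) q = ws p i * q.derivative.eval (xs p i) := by
  have hx : ∀ i', xs (Pi.single j (1 : ℝ)) i' = if i' = i then 1 else 0 := by
    intro i'
    have : 2 * (i' : ℕ) < 2 * N - 1 := by omega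
    simp only [xs, ext0_lt _ this, Pi.single_apply, Fin.ext_iff]
    congr 1; simp; omega
  have hw : ∀ i', dws (Pi.single j (1 : ℝ)) i' = 0 := by
    intro i'
    have : ∀ k, k ≠ j.1 → ext0 (Pi.single j (1 : ℝ) : Fin (2 * N - 1) → ℝ) k = 0 := by
      intro k hk
      unfold ext0
      split_ifs
      · simp [Pi.single_apply, Fin.ext_iff, hk]
      · rfl
    unfold dws
    split_ifs
    · rw [Finset.sum_eq_zero, neg_zero]
      intro l _; apply this; omega
    · apply this; omega
  rw [dInt_apply]
  simp [hx, hw]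

lemma dInt_odd {N : ℕ} (p : Fin (2 * N - 1) → ℝ) (j : Fin (2 * N - 1)) (i : ℕ)
    (hj : (j : ℕ) = 2 * i + 1) (q : Polynomial ℝ) :
    dInt p (Pi.single j 1) q = q.eval (ext0 p (2 * (i + 1))) - q.eval (ext0 p 0) := by
  have hjlt := j.2
  obtain ⟨n, rfl⟩ : ∃ n, N = n + 1 := ⟨N - 1, by omega⟩
  have hx : ∀ i', xs (Pi.single j (1 : ℝ)) i' = 0 := by
    intro i'
    have : 2 * (i' : ℕ) < 2 * (n + 1) - 1 := by omega
    simp only [xs, ext0_lt _ this, Pi.single_apply, Fin.ext_iff]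
    rw [if_neg]; omega
  have hs : ∀ k, ext0 (Pi.single j (1 : ℝ) : Fin (2 * (n + 1) - 1) → ℝ) k =
      if k = j.1 then 1 else 0 := by
    intro k
    unfold ext0
    split_ifs with h1 h2 h2
    · simp [Pi.single_apply, Fin.ext_iff, h2]
    · simp [Pi.single_apply, Fin.ext_iff, h2]
    · omega
    · rfl
  rw [dInt_apply]
  simp only [hx, mul_zero, zero_mul, add_zero]
  rw [Fin.sum_univ_succ]
  have h0 : dws (Pi.single j (1 : ℝ)) (0 : Fin (n + 1)) = -1 := by
    simp only [dws, hs, hj]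
    simp
    omega
  have h1 : ∀ l : Fin n, dws (Pi.single j (1 : ℝ)) l.succ = if l = ⟨i, by omega⟩ then 1 else 0 := by
    intro l
    simp only [dws, hs, hj, Fin.ext_iff, Fin.val_succ]
    simp
    congr 1
    simp; omega
  simp only [h0, h1]
  simp [xs]
  ring

/-- The diagonal entries of the triangularised Jacobian of `momG`. -/
def diagG {N : ℕ} (p : Fin (2 * N - 1) → ℝ) (k : ℕ) : ℝ :=
  if k % 2 = 0 then (if h : k / 2 < N then ws p ⟨k / 2, h⟩ else 0) *
    (newt p k).eval (ext0 p k)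
  else (newt p (k + 1)).eval (ext0 p (k + 1))

lemma dInt_newt {N : ℕ} (p : Fin (2 * N - 1) → ℝ) (k j : Fin (2 * N - 1)) (hkj : j ≤ k) :
    dInt p (Pi.single j 1) (newt p (k + 1)) = if j = k then diagG p k else 0 := by
  have hkj' : (j : ℕ) ≤ k := hkj
  rcases Nat.even_or_odd' (j : ℕ) with ⟨i, hi | hi⟩
  · rw [dInt_even p j ⟨i, by omega⟩ hi]
    simp only [xs]
    split_ifs with h
    · subst h
      rw [hi, newt_deriv_eval, diagG]
      have : i < N := by omega
      simp [this]
    · have : (j : ℕ) ≠ k := fun h' => h (Fin.ext h')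
      rw [newt_deriv_eval_zero _ (by omega), mul_zero]
  · rw [dInt_odd p j i hi]
    have h00 : (newt p ((k : ℕ) + 1)).eval (ext0 p 0) = 0 := newt_eval_zero p (i := 0) (by omega)
    rw [h00, sub_zero]
    split_ifs with h
    · subst h
      rw [diagG, if_neg (by omega), hi]
      rfl
    · have : (j : ℕ) ≠ k := fun h' => h (Fin.ext h')
      rw [newt_eval_zero _ (by omega)]

lemma dInt_one {N : ℕ} (hN : 0 < N) (p v : Fin (2 * N - 1) → ℝ) : dInt p v 1 = 0 := by
  rw [dInt_apply]; simp [sum_dws hN]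

lemma det_fderiv_momG_aux {N : ℕ} (hN : 0 < N) (p : Fin (2 * N - 1) → ℝ) :
    (fderiv ℝ momG p).det = ∏ k : Fin (2 * N - 1), diagG p k := by
  set M : Matrix (Fin (2 * N - 1)) (Fin (2 * N - 1)) ℝ :=
    LinearMap.toMatrix' (fderiv ℝ momG p : (Fin (2 * N - 1) → ℝ) →ₗ[ℝ] (Fin (2 * N - 1) → ℝ)) with hM
  have h0 : (fderiv ℝ momG p).det = M.det := by
    rw [hM, LinearMap.det_toMatrix']
  have hent : ∀ k j, M k j = dInt p (Pi.single j 1) (Polynomial.X ^ ((k : ℕ) + 1)) := by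
    intro k j
    rw [hM, LinearMap.toMatrix'_apply, ← fderiv_momG_apply]
    have h4 : (fun j' => if j' = j then (1 : ℝ) else 0) = Pi.single j 1 := by
      ext i; simp [Pi.single_apply]
    simp [h4]
  set A : Matrix (Fin (2 * N - 1)) (Fin (2 * N - 1)) ℝ :=
    Matrix.of fun k k' => (newt p ((k : ℕ) + 1)).coeff ((k' : ℕ) + 1) with hA
  have hAdet : A.det = 1 := by
    rw [Matrix.det_of_lowerTriangular]
    · refine Finset.prod_eq_one fun k _ => ?_
      have := (newt_monic p ((k : ℕ) + 1)).coeff_natDegree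
      rw [newt_natDegree] at this
      simpa [hA] using this
    · intro i j hij
      have hij' : (i : ℕ) < j := hij
      simp only [hA, Matrix.of_apply]
      apply Polynomial.coeff_eq_zero_of_natDegree_lt
      rw [newt_natDegree]; omega
  have hAM : ∀ k j, (A * M) k j = dInt p (Pi.single j 1) (newt p ((k : ℕ) + 1)) := by
    intro k j
    have h1 := (newt p ((k : ℕ) + 1)).as_sum_range' (2 * N - 1 + 1) (by rw [newt_natDegree]; omega)
    rw [Matrix.mul_apply]
    conv_rhs => rw [h1, map_sum, Finset.sum_range_succ']
    have h2 : ∀ n (r : ℝ), dInt p (Pi.single j 1) (Polynomial.monomial n r) =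
        r * dInt p (Pi.single j 1) (Polynomial.X ^ n) := by
      intro n r
      rw [← Polynomial.C_mul_X_pow_eq_monomial, Polynomial.C_mul', map_smul, smul_eq_mul]
    simp only [h2, pow_zero, dInt_one hN, mul_zero, add_zero]
    rw [Finset.sum_range]
    refine Finset.sum_congr rfl fun k' _ => ?_
    rw [hent]; rfl
  have h5 : M.det = (A * M).det := by rw [Matrix.det_mul, hAdet, one_mul]
  rw [h0, h5, Matrix.det_of_upperTriangular]
  · refine Finset.prod_congr rfl fun k _ => ?_
    rw [hAM, dInt_newt _ _ _ le_rfl, if_pos rfl]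
  · intro i j hij
    have hij' : j < i := hij
    rw [hAM, dInt_newt _ _ _ hij'.le, if_neg hij'.ne]

lemma prod_range_odd (d : ℕ → ℝ) (n : ℕ) :
    ∏ k ∈ Finset.range (2 * n + 1), d k =
      d 0 * ∏ i ∈ Finset.range n, (d (2 * i + 1) * d (2 * i + 2)) := by
  induction n with
  | zero => simp
  | succ n ih =>
    rw [show 2 * (n + 1) + 1 = 2 * n + 1 + 1 + 1 by ring, Finset.prod_range_succ,
      Finset.prod_range_succ, ih, Finset.prod_range_succ]
    ring

lemma vdm_eq {N : ℕ} (x : Fin N → ℝ) : vdm x = ∏ j : Fin N, ∏ i ∈ Finset.Iio j, (x j - x i) := by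
  unfold vdm
  apply Finset.prod_comm'
  simp

lemma prod_Iio_fin {N : ℕ} (j : Fin N) (f : ℕ → ℝ) :
    ∏ i ∈ Finset.Iio j, f i = ∏ i ∈ Finset.range j, f i := by
  refine Finset.prod_bij (fun i _ => (i : ℕ)) ?_ ?_ ?_ ?_
  · intro i hi; simpa using hi
  · intro i _ j _ h; exact Fin.ext h
  · intro i hi
    have hi' := Finset.mem_range.1 hi
    exact ⟨⟨i, by omega⟩, by simpa [Fin.lt_def] using hi', rfl⟩
  · intro i _; rfl

lemma det_fderiv_momG {N : ℕ} (hN : 0 < N) (p : Fin (2 * N - 1) → ℝ) :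
    (fderiv ℝ momG p).det = (∏ i, ws p i) * vdm (xs p) ^ 4 := by
  rw [det_fderiv_momG_aux hN, vdm_eq, ← Finset.prod_pow, ← Finset.prod_mul_distrib,
    ← Finset.prod_range (fun k => diagG p k)]
  have h1 : ∀ j : Fin N, (∏ i ∈ Finset.Iio j, (xs p j - xs p i)) ^ 4 =
      ((newt p (2 * j)).eval (ext0 p (2 * j))) ^ 2 := by
    intro j
    unfold xs
    rw [prod_Iio_fin j (fun i => ext0 p (2 * j) - ext0 p (2 * i)), newt_eval, Finset.prod_pow]
    ring
  simp only [h1]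
  obtain ⟨n, rfl⟩ : ∃ n, N = n + 1 := ⟨N - 1, by omega⟩
  refine (prod_range_odd (diagG p) n).trans ?_
  rw [Fin.prod_univ_succ]
  have h2 : diagG p 0 = ws p 0 * (newt p (2 * ((0 : Fin (n + 1)) : ℕ))).eval (ext0 p (2 * ((0 : Fin (n + 1)) : ℕ))) ^ 2 := by
    simp [diagG, newt]
  rw [h2, Finset.prod_range]
  congr 1
  refine Finset.prod_congr rfl fun i _ => ?_
  have e1 : (2 * (i : ℕ) + 1) % 2 = 1 := by omega
  have e2 : (2 * (i : ℕ) + 2) % 2 = 0 := by omega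
  have e3 : (2 * (i : ℕ) + 2) / 2 = i + 1 := by omega
  have e4 : (i : ℕ) + 1 < n + 1 := by omega
  have e5 : (⟨(i : ℕ) + 1, e4⟩ : Fin (n + 1)) = i.succ := rfl
  simp only [diagG, e1, e2, e3, e4, dif_pos, if_true, e5, Fin.val_succ]
  rw [if_neg (by norm_num)]
  simp only [show 2 * ((i : ℕ) + 1) = 2 * i + 2 by ring, show 2 * (i : ℕ) + 1 + 1 = 2 * i + 2 by ring]
  ring

/-- The domain of spectral data. -/
def specDom (N : ℕ) : Set (Fin (2 * N - 1) → ℝ) :=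
  {p | (∀ i j : Fin N, i < j → xs p j < xs p i) ∧ (∀ i : Fin N, xs p i ∈ Set.Ioo (0 : ℝ) 1) ∧
    ∀ i : Fin N, 0 < ws p i}

lemma isOpen_specDom (N : ℕ) : IsOpen (specDom N) := by
  have hx : ∀ i : Fin N, Continuous fun p : Fin (2 * N - 1) → ℝ => xs p i :=
    fun i => (contDiff_xs i).continuous
  have hw : ∀ i : Fin N, Continuous fun p : Fin (2 * N - 1) → ℝ => ws p i :=
    fun i => (contDiff_ws i).continuous
  unfold specDom
  simp only [Set.ofPred_and, Set.ofPred_forall]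
  refine IsOpen.inter ?_ (IsOpen.inter ?_ ?_)
  · refine isOpen_iInter_of_finite fun i => isOpen_iInter_of_finite fun j =>
      isOpen_iInter_of_finite fun _ => isOpen_lt (hx j) (hx i)
  · exact isOpen_iInter_of_finite fun i => isOpen_Ioo.preimage (hx i)
  · exact isOpen_iInter_of_finite fun i => isOpen_lt continuous_const (hw i)

lemma xs_comb {N : ℕ} (p q : Fin (2 * N - 1) → ℝ) (s t : ℝ) (i : Fin N) :
    xs (s • p + t • q) i = s * xs p i + t * xs q i := by
  unfold xs ext0; split_ifs <;> simp

lemma ws_comb {N : ℕ} (p q : Fin (2 * N - 1) → ℝ) (s t : ℝ) (hst : s + t = 1) (i : Fin N) :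
    ws (s • p + t • q) i = s * ws p i + t * ws q i := by
  have h : ∀ k, ext0 (s • p + t • q) k = s * ext0 p k + t * ext0 q k := by
    intro k; unfold ext0; split_ifs <;> simp
  unfold ws
  split_ifs
  · simp only [h, Finset.sum_add_distrib, ← Finset.mul_sum]
    linear_combination -hst
  · exact h _

lemma convex_specDom (N : ℕ) : Convex ℝ (specDom N) := by
  intro p hp q hq s t hs ht hst
  refine ⟨fun i j hij => ?_, fun i => ?_, fun i => ?_⟩
  · rw [xs_comb, xs_comb]
    have h1 := hp.1 i j hij
    have h2 := hq.1 i j hij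
    have := convex_Ioi (0 : ℝ) (x := xs p i - xs p j) (by simpa using h1)
      (y := xs q i - xs q j) (by simpa using h2) hs ht hst
    simp only [smul_eq_mul, Set.mem_Ioi] at this
    linarith
  · rw [xs_comb]
    exact convex_Ioo (0 : ℝ) 1 (hp.2.1 i) (hq.2.1 i) hs ht hst
  · rw [ws_comb _ _ _ _ hst]
    exact convex_Ioi (0 : ℝ) (hp.2.2 i) (hq.2.2 i) hs ht hst

lemma polInt_congr {N : ℕ} (hN : 0 < N) {p p' : Fin (2 * N - 1) → ℝ} (h : momG p = momG p')
    (q : Polynomial ℝ) (hq : q.natDegree < 2 * N) : polInt q p = polInt q p' := by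
  have hpow : ∀ k < 2 * N, polInt (Polynomial.X ^ k) p = polInt (Polynomial.X ^ k) p' := by
    intro k hk
    obtain _ | k := k
    · simp [polInt, sum_ws hN]
    · exact congrFun h ⟨k, by omega⟩
  have hexp : ∀ p : Fin (2 * N - 1) → ℝ, polInt q p =
      ∑ k ∈ Finset.range (2 * N), q.coeff k * polInt (Polynomial.X ^ k) p := by
    intro p
    unfold polInt
    simp_rw [Polynomial.eval_eq_sum_range' hq, Finset.mul_sum]
    rw [Finset.sum_comm]
    refine Finset.sum_congr rfl fun k _ => Finset.sum_congr rfl fun i _ => ?_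
    simp; ring
  rw [hexp, hexp]
  refine Finset.sum_congr rfl fun k hk => ?_
  rw [hpow k (Finset.mem_range.1 hk)]

lemma strictAnti_eq_of_subset {N : ℕ} {x y : Fin N → ℝ} (hx : ∀ i j, i < j → x j < x i)
    (hy : ∀ i j, i < j → y j < y i) (h : ∀ i, ∃ j, y i = x j) : y = x := by
  choose f hf using h
  have hfm : StrictMono f := by
    intro i j hij
    by_contra hle
    have h1 := hy i j hij
    rw [hf i, hf j] at h1
    rcases (not_lt.1 hle).lt_or_eq with h2 | h2
    · exact absurd (hx _ _ h2) (not_lt.2 h1.le)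
    · rw [h2] at h1; exact lt_irrefl _ h1
  have : f = id := by
    have h2 : Set.range f = Set.range id := by
      rw [Set.range_id]
      exact (Finite.surjective_of_injective hfm.injective).range_eq
    exact (StrictMono.range_inj hfm strictMono_id).1 h2
  ext i
  rw [hf i, this]; rfl

lemma eq_of_xs_ws {N : ℕ} (p p' : Fin (2 * N - 1) → ℝ) (hx : xs p = xs p') (hw : ws p = ws p') :
    p = p' := by
  ext k
  rcases Nat.even_or_odd' (k : ℕ) with ⟨i, hi | hi⟩
  · have := congrFun hx ⟨i, by omega⟩
    simp only [xs, ← hi, ext0_fin] at this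
    exact this
  · have := congrFun hw ⟨i + 1, by omega⟩
    simp only [ws, Nat.add_one_ne_zero, if_false, show 2 * (i + 1) - 1 = (k : ℕ) by omega,
      ext0_fin] at this
    exact this

lemma injOn_momG {N : ℕ} (hN : 0 < N) :
    Set.InjOn (momG : (Fin (2 * N - 1) → ℝ) → (Fin (2 * N - 1) → ℝ)) (specDom N) := by
  intro p hp p' hp' h
  have hinj : ∀ p ∈ specDom N, Function.Injective (xs p) := by
    intro p hp i j hij
    by_contra hne
    rcases lt_or_gt_of_ne hne with h1 | h1
    · exact (hp.1 _ _ h1).ne' hij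
    · exact (hp.1 _ _ h1).ne hij
  -- Lagrange-type polynomial
  let L : (Fin (2 * N - 1) → ℝ) → Fin N → Polynomial ℝ := fun p i =>
    ∏ j ∈ Finset.univ.erase i, (Polynomial.X - Polynomial.C (xs p j))
  have hLdeg : ∀ p i, (L p i).natDegree = N - 1 := by
    intro p i
    simp only [L]
    rw [Polynomial.natDegree_prod_of_monic _ _ fun _ _ => Polynomial.monic_X_sub_C _]
    simp
  have hLne : ∀ p ∈ specDom N, ∀ i, (L p i).eval (xs p i) ≠ 0 := by
    intro p hp i
    simp only [L, Polynomial.eval_prod, Polynomial.eval_sub, Polynomial.eval_X, Polynomial.eval_C]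
    refine Finset.prod_ne_zero_iff.2 fun j hj => ?_
    rw [sub_ne_zero]
    exact fun h => (Finset.ne_of_mem_erase hj) (hinj p hp h).symm
  have hLz : ∀ p i j, j ≠ i → (L p i).eval (xs p j) = 0 := by
    intro p i j hj
    simp only [L, Polynomial.eval_prod, Polynomial.eval_sub, Polynomial.eval_X, Polynomial.eval_C]
    exact Finset.prod_eq_zero (Finset.mem_erase.2 ⟨hj, Finset.mem_univ j⟩) (sub_self _)
  have hx : xs p' = xs p := by
    refine strictAnti_eq_of_subset hp.1 hp'.1 fun i => ?_
    let P : Polynomial ℝ := ∏ j : Fin N, (Polynomial.X - Polynomial.C (xs p j))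
    have hPdeg : P.natDegree = N := by
      simp only [P]
      rw [Polynomial.natDegree_prod_of_monic _ _ fun _ _ => Polynomial.monic_X_sub_C _]
      simp
    have h1 := polInt_congr hN h (P * L p' i) (by
      refine lt_of_le_of_lt Polynomial.natDegree_mul_le ?_
      rw [hPdeg, hLdeg]; omega)
    have h2 : polInt (P * L p' i) p = 0 := by
      unfold polInt
      refine Finset.sum_eq_zero fun j _ => ?_
      have : P.eval (xs p j) = 0 := by
        simp only [P, Polynomial.eval_prod]
        exact Finset.prod_eq_zero (Finset.mem_univ j) (by simp)
      simp [this]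
    have h3 : polInt (P * L p' i) p' = ws p' i * (P.eval (xs p' i) * (L p' i).eval (xs p' i)) := by
      unfold polInt
      rw [Finset.sum_eq_single i]
      · simp
      · intro j _ hj
        simp [hLz p' i j hj]
      · simp
    rw [h2, h3] at h1
    have h4 : P.eval (xs p' i) = 0 := by
      by_contra hne
      exact (mul_ne_zero (hp'.2.2 i).ne' (mul_ne_zero hne (hLne p' hp' i))) h1.symm
    simp only [P, Polynomial.eval_prod, Polynomial.eval_sub, Polynomial.eval_X,
      Polynomial.eval_C] at h4
    obtain ⟨j, _, hj⟩ := Finset.prod_eq_zero_iff.1 h4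
    exact ⟨j, by linarith⟩
  have hw : ws p' = ws p := by
    ext i
    have h1 := polInt_congr hN h (L p i) (by rw [hLdeg]; omega)
    have h3 : ∀ p'', xs p'' = xs p → polInt (L p i) p'' = ws p'' i * (L p i).eval (xs p i) := by
      intro p'' hxx
      unfold polInt
      rw [hxx, Finset.sum_eq_single i]
      · intro j _ hj
        simp [hLz p i j hj]
      · simp
    rw [h3 p rfl, h3 p' hx] at h1
    exact (mul_right_cancel₀ (hLne p hp i) h1).symm
  exact eq_of_xs_ws _ _ hx.symm hw.symm

/-! ### Part C: spectral analysis of the Jacobi matrix -/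

/-- Symmetric tridiagonal matrix from sequences. -/
def triMat (N : ℕ) (α γ : ℕ → ℝ) : Matrix (Fin N) (Fin N) ℝ :=
  Matrix.of fun i j => (if (i : ℕ) = j then α i else 0) + (if (i : ℕ) + 1 = j then γ i else 0) +
    (if (j : ℕ) + 1 = i then γ j else 0)

/-- Lower bidiagonal matrix from sequences. -/
def biMat (N : ℕ) (δ ε : ℕ → ℝ) : Matrix (Fin N) (Fin N) ℝ :=
  Matrix.of fun i j => (if (i : ℕ) = j then δ i else 0) + (if (j : ℕ) + 1 = i then ε j else 0)

lemma sum_fin_ite_eq {N : ℕ} (a : ℕ) (f : ℕ → ℝ) :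
    ∑ l : Fin N, (if a = (l : ℕ) then f l else 0) = if a < N then f a else 0 := by
  rw [← Finset.sum_range (fun l => if a = l then f l else 0), Finset.sum_ite_eq]
  simp

lemma sum_fin_ite_succ {N : ℕ} (a : ℕ) (ha : a < N) (f : ℕ → ℝ) :
    ∑ l : Fin N, (if (l : ℕ) + 1 = a then f l else 0) = if a = 0 then 0 else f (a - 1) := by
  by_cases h : a = 0
  · simp [h]
  · have : ∀ l : Fin N, (if (l : ℕ) + 1 = a then f l else 0) =
        if a - 1 = (l : ℕ) then f l else 0 := by
      intro l
      congr 1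
      simp; omega
    simp only [this]
    rw [sum_fin_ite_eq, if_pos (by omega), if_neg h]

lemma biMat_mul_transpose (N : ℕ) (δ ε : ℕ → ℝ) :
    biMat N δ ε * (biMat N δ ε)ᵀ =
      triMat N (fun n => δ n ^ 2 + if n = 0 then 0 else ε (n - 1) ^ 2) (fun n => δ n * ε n) := by
  ext i j
  rw [Matrix.mul_apply]
  simp only [Matrix.transpose_apply]
  have h1 : ∀ l : Fin N, biMat N δ ε i l * biMat N δ ε j l =
      (if (i : ℕ) = l then δ i * ((if (j : ℕ) = l then δ j else 0) +
        (if (l : ℕ) + 1 = j then ε l else 0)) else 0) +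
      (if (l : ℕ) + 1 = i then ε l * ((if (j : ℕ) = l then δ j else 0) +
        (if (l : ℕ) + 1 = j then ε l else 0)) else 0) := by
    intro l
    simp only [biMat, Matrix.of_apply, add_mul, ite_mul, zero_mul]
  simp only [h1, Finset.sum_add_distrib]
  rw [sum_fin_ite_eq (i : ℕ) (fun l => δ i * ((if (j : ℕ) = l then δ j else 0) +
        (if (l : ℕ) + 1 = j then ε l else 0))), if_pos i.2,
    sum_fin_ite_succ (i : ℕ) i.2 (fun l => ε l * ((if (j : ℕ) = l then δ j else 0) +
        (if (l : ℕ) + 1 = j then ε l else 0)))]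
  simp only [triMat, Matrix.of_apply]
  have hj := j.2
  have hi := i.2
  generalize (i : ℕ) = a at *
  generalize (j : ℕ) = b at *
  obtain _ | a := a
  · by_cases hb0 : b = 0
    · subst hb0; simp; ring
    · by_cases hb1 : b = 1
      · subst hb1; simp
      · have e1 : ¬ (1 = b) := by omega
        have e2 : ¬ (0 = b) := by omega
        simp [hb0, e1, e2]
  · by_cases h1 : b = a + 1
    · subst h1; simp; ring
    · by_cases h2 : b = a
      · subst h2; simp; ring
      · by_cases h3 : b = a + 2
        · subst h3; simp
        · have e1 : ¬ (a + 1 = b) := by omega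
          have e2 : ¬ (a + 1 + 1 = b) := by omega
          simp [h1, h2, e1, e2]

lemma det_biMat (N : ℕ) (δ ε : ℕ → ℝ) : (biMat N δ ε).det = ∏ n ∈ Finset.range N, δ n := by
  rw [Matrix.det_of_lowerTriangular, Finset.prod_range]
  · refine Finset.prod_congr rfl fun i _ => ?_
    simp [biMat]
  · intro i j hij
    have hij' : (i : ℕ) < j := hij
    have e1 : ¬ ((i : ℕ) = j) := by omega
    have e2 : ¬ ((j : ℕ) + 1 = i) := by omega
    simp [biMat, e1, e2]

/-- Diagonal Jacobi coefficients from the chain sequence. -/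
def aSeq (ξ : ℕ → ℝ) (n : ℕ) : ℝ := if n = 0 then ξ 0 else ξ (2 * n - 1) + ξ (2 * n)

/-- Squared off-diagonal Jacobi coefficients from the chain sequence. -/
def bSeq (ξ : ℕ → ℝ) (n : ℕ) : ℝ := ξ (2 * n) * ξ (2 * n + 1)

/-- The Jacobi matrix attached to canonical moments. -/
abbrev jacC {N : ℕ} (c : Fin (2 * N - 1) → ℝ) : Matrix (Fin N) (Fin N) ℝ :=
  jacobiMatrix (xiToA (cToXi c)) (xiToB (cToXi c))

lemma jacC_eq {N : ℕ} (c : Fin (2 * N - 1) → ℝ) :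
    jacC c = triMat N (aSeq (chainSeq (ext0 c))) (fun n => √(bSeq (chainSeq (ext0 c)) n)) := by
  have hx : ∀ k (h : k < 2 * N - 1), cToXi c ⟨k, h⟩ = chainSeq (ext0 c) k := by
    intro k h
    rw [← ext0_cToXi, ext0_lt _ h]
  ext i j
  simp only [jacC, jacobiMatrix, triMat, Matrix.of_apply, xiToA, xiToB, hx, aSeq, bSeq, Fin.ext_iff]
  by_cases h1 : (i : ℕ) = j
  · have e1 : ¬ ((i : ℕ) + 1 = j) := by omega
    have e2 : ¬ ((j : ℕ) + 1 = i) := by omega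
    simp only [h1, if_true]
    simp
  · by_cases h2 : (i : ℕ) + 1 = j
    · have e2 : ¬ ((j : ℕ) + 1 = i) := by omega
      simp [h1, h2, e2]
    · by_cases h3 : (j : ℕ) + 1 = i
      · simp [h1, h2, h3]
      · simp [h1, h2, h3]

lemma triMat_congr {N : ℕ} {α γ α' γ' : ℕ → ℝ} (h1 : ∀ n < N, α n = α' n)
    (h2 : ∀ n < N, γ n = γ' n) : triMat N α γ = triMat N α' γ' := by
  ext i j
  simp only [triMat, Matrix.of_apply, h1 _ i.2, h2 _ i.2, h2 _ j.2]

lemma ext0_cube {m : ℕ} {c : Fin m → ℝ} (hc : c ∈ cube m) (k : ℕ) :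
    0 ≤ ext0 c k ∧ 0 ≤ 1 - ext0 c k := by
  by_cases h : k < m
  · have := cube_ext hc h; constructor <;> linarith
  · rw [ext0_ge _ (by omega)]; norm_num

lemma prevC_nonneg {m : ℕ} {c : Fin m → ℝ} (hc : c ∈ cube m) (k : ℕ) : 0 ≤ prevC (ext0 c) k := by
  unfold prevC
  split_ifs
  · norm_num
  · exact (ext0_cube hc _).2

lemma chainSeq_nonneg {m : ℕ} {c : Fin m → ℝ} (hc : c ∈ cube m) (k : ℕ) :
    0 ≤ chainSeq (ext0 c) k := by
  rw [chainSeq_eq]; exact mul_nonneg (prevC_nonneg hc k) (ext0_cube hc k).1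

lemma jacC_fact {N : ℕ} {c : Fin (2 * N - 1) → ℝ} (hc : c ∈ cube (2 * N - 1)) :
    jacC c = biMat N (fun n => √(chainSeq (ext0 c) (2 * n))) (fun n => √(chainSeq (ext0 c) (2 * n + 1))) *
      (biMat N (fun n => √(chainSeq (ext0 c) (2 * n))) (fun n => √(chainSeq (ext0 c) (2 * n + 1))))ᵀ := by
  rw [jacC_eq, biMat_mul_transpose]
  refine triMat_congr (fun n _ => ?_) (fun n _ => ?_)
  · simp only [Real.sq_sqrt (chainSeq_nonneg hc _), aSeq]
    obtain _ | n := n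
    · simp
    · simp only [Nat.add_one_ne_zero, if_false, Nat.add_sub_cancel]
      rw [show 2 * (n + 1) - 1 = 2 * n + 1 by omega]; ring
  · rw [bSeq, Real.sqrt_mul (chainSeq_nonneg hc _)]

lemma one_sub_jacC_fact {N : ℕ} {c : Fin (2 * N - 1) → ℝ} (hc : c ∈ cube (2 * N - 1)) :
    1 - jacC c = biMat N (fun n => √(prevC (ext0 c) (2 * n) * (1 - ext0 c (2 * n))))
        (fun n => -√(ext0 c (2 * n) * ext0 c (2 * n + 1))) *
      (biMat N (fun n => √(prevC (ext0 c) (2 * n) * (1 - ext0 c (2 * n))))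
        (fun n => -√(ext0 c (2 * n) * ext0 c (2 * n + 1))))ᵀ := by
  have h1 : 1 - jacC c = triMat N (fun n => 1 - aSeq (chainSeq (ext0 c)) n)
      (fun n => -√(bSeq (chainSeq (ext0 c)) n)) := by
    rw [jacC_eq]
    ext i j
    simp only [Matrix.sub_apply, triMat, Matrix.of_apply, Matrix.one_apply, Fin.ext_iff]
    split_ifs <;> first | omega | ring
  rw [h1, biMat_mul_transpose]
  refine triMat_congr (fun n _ => ?_) (fun n _ => ?_)
  · simp only [neg_sq, Real.sq_sqrt (mul_nonneg (prevC_nonneg hc _) (ext0_cube hc _).2),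
      Real.sq_sqrt (mul_nonneg (ext0_cube hc _).1 (ext0_cube hc _).1), aSeq]
    obtain _ | n := n
    · simp [chainSeq, prevC]
    · simp only [Nat.add_one_ne_zero, if_false, Nat.add_sub_cancel, chainSeq, prevC,
        show 2 * (n + 1) - 1 = 2 * n + 1 by omega, show 2 * (n + 1) = 2 * n + 2 by ring,
        show 2 * n + 2 - 1 = 2 * n + 1 by omega]
      ring
  · rw [mul_neg, ← Real.sqrt_mul (mul_nonneg (prevC_nonneg hc _) (ext0_cube hc _).2), bSeq,
      chainSeq_eq, chainSeq_eq]
    congr 2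
    have : prevC (ext0 c) (2 * n + 1) = 1 - ext0 c (2 * n) := by simp [prevC]
    rw [this]; ring

lemma triMat_mulVec {N : ℕ} (α γ v : ℕ → ℝ) (n : Fin N) :
    ∑ m : Fin N, triMat N α γ n m * v m = α n * v n +
      (if (n : ℕ) + 1 < N then γ n * v (n + 1) else 0) +
      (if (n : ℕ) = 0 then 0 else γ (n - 1) * v (n - 1)) := by
  simp only [triMat, Matrix.of_apply, add_mul, Finset.sum_add_distrib, ite_mul, zero_mul]
  rw [sum_fin_ite_eq (n : ℕ) (fun m => α n * v m), sum_fin_ite_eq ((n : ℕ) + 1) (fun m => γ n * v m),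
    sum_fin_ite_succ (n : ℕ) n.2 (fun m => γ m * v m), if_pos n.2]

/-- Krylov vectors `J^k e_0`. -/
def kry (ξ : ℕ → ℝ) (k n : ℕ) : ℝ := √(∏ l ∈ Finset.range n, bSeq ξ l) * walk ξ (2 * k) (2 * n)

lemma kry_step {N : ℕ} {ξ : ℕ → ℝ} (hξ : ∀ k, 0 ≤ ξ k) (hz : ξ (2 * N - 1) = 0) (k : ℕ) (n : Fin N) :
    ∑ m : Fin N, triMat N (aSeq ξ) (fun n => √(bSeq ξ n)) n m * kry ξ k m = kry ξ (k + 1) n := by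
  rw [triMat_mulVec _ _ (kry ξ k) n]
  have hb : ∀ n, 0 ≤ bSeq ξ n := fun n => mul_nonneg (hξ _) (hξ _)
  have hB : ∀ n, 0 ≤ ∏ l ∈ Finset.range n, bSeq ξ l := fun n => Finset.prod_nonneg fun l _ => hb l
  have hup : (if (n : ℕ) + 1 < N then √(bSeq ξ n) * kry ξ k (n + 1) else 0) =
      √(∏ l ∈ Finset.range n, bSeq ξ l) * (bSeq ξ n * walk ξ (2 * k) (2 * n + 2)) := by
    split_ifs with h
    · unfold kry
      rw [Finset.prod_range_succ, Real.sqrt_mul (hB _)]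
      rw [show 2 * ((n : ℕ) + 1) = 2 * n + 2 by ring]
      have := Real.mul_self_sqrt (hb n)
      linear_combination (√(∏ l ∈ Finset.range n, bSeq ξ l) * walk ξ (2 * k) (2 * n + 2)) * this
    · have : bSeq ξ n = 0 := by
        rw [bSeq, show 2 * (n : ℕ) + 1 = 2 * N - 1 by omega, hz, mul_zero]
      rw [this]; ring
  rw [hup]
  generalize (n : ℕ) = m
  obtain _ | m := m
  · simp [kry, aSeq, bSeq, show 2 * (k + 1) = 2 * k + 1 + 1 by ring, walk]
    ring
  · have hd : √(bSeq ξ m) * kry ξ k m = √(∏ l ∈ Finset.range (m + 1), bSeq ξ l) * walk ξ (2 * k) (2 * m) := by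
      unfold kry
      rw [Finset.prod_range_succ, Real.sqrt_mul (hB _)]; ring
    simp only [Nat.add_one_ne_zero, if_false, Nat.add_sub_cancel, hd]
    unfold kry
    rw [show 2 * (k + 1) = 2 * k + 1 + 1 by ring, show 2 * (m + 1) = 2 * m + 1 + 1 by ring]
    simp only [walk, aSeq, bSeq, Nat.add_one_ne_zero, if_false,
      show 2 * (m + 1) = 2 * m + 1 + 1 by ring, Nat.add_sub_cancel]
    ring

/-- Orthonormal eigenbasis data in matrix form. -/
structure EigData {N : ℕ} (J : Matrix (Fin N) (Fin N) ℝ) (U : Fin N → Fin N → ℝ)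
    (lam : Fin N → ℝ) : Prop where
  orth : ∀ n m, ∑ l, U n l * U m l = if n = m then 1 else 0
  orth' : ∀ l m, ∑ n, U n l * U n m = if l = m then 1 else 0
  eig : ∀ n l, ∑ m, J n m * U m l = lam l * U n l

lemma kry_spectral {N : ℕ} (hN : 0 < N) {ξ : ℕ → ℝ} (hξ : ∀ k, 0 ≤ ξ k) (hz : ξ (2 * N - 1) = 0)
    {U : Fin N → Fin N → ℝ} {lam : Fin N → ℝ}
    (h : EigData (triMat N (aSeq ξ) (fun n => √(bSeq ξ n))) U lam) (k : ℕ) :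
    ∀ n : Fin N, kry ξ k n = ∑ l, U n l * (U ⟨0, hN⟩ l * lam l ^ k) := by
  induction k with
  | zero =>
    intro n
    simp only [pow_zero, mul_one]
    rw [h.orth]
    simp only [kry, walk, Fin.ext_iff, mul_zero]
    by_cases h0 : (n : ℕ) = 0
    · simp [h0]
    · simp [h0]
  | succ k ih =>
    intro n
    rw [← kry_step hξ hz k n]
    simp only [ih, Finset.mul_sum]
    rw [Finset.sum_comm]
    refine Finset.sum_congr rfl fun l _ => ?_
    have := h.eig n l
    calc _ = (∑ m, triMat N (aSeq ξ) (fun n => √(bSeq ξ n)) n m * U m l) * (U ⟨0, hN⟩ l * lam l ^ k) := by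
          rw [Finset.sum_mul]; refine Finset.sum_congr rfl fun m _ => by ring
      _ = _ := by rw [this]; ring

lemma vdm_weights {N : ℕ} (hN : 0 < N) {ξ : ℕ → ℝ} (hξ : ∀ k, 0 ≤ ξ k) (hz : ξ (2 * N - 1) = 0)
    {U : Fin N → Fin N → ℝ} {lam : Fin N → ℝ}
    (h : EigData (triMat N (aSeq ξ) (fun n => √(bSeq ξ n))) U lam) :
    vdm lam ^ 2 * ∏ l, U ⟨0, hN⟩ l ^ 2 =
      ∏ k ∈ Finset.range N, ∏ l ∈ Finset.range k, bSeq ξ l := by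
  set K : Matrix (Fin N) (Fin N) ℝ := Matrix.of fun n k => kry ξ k n with hK
  have h1 : K = Matrix.of U * (Matrix.diagonal (U ⟨0, hN⟩) * Matrix.vandermonde lam) := by
    ext n k
    rw [Matrix.mul_apply]
    simp only [hK, Matrix.of_apply, kry_spectral hN hξ hz h, Matrix.diagonal_mul,
      Matrix.vandermonde_apply]
  have h2 : K.det = ∏ k ∈ Finset.range N, √(∏ l ∈ Finset.range k, bSeq ξ l) := by
    rw [Matrix.det_of_upperTriangular, Finset.prod_range]
    · refine Finset.prod_congr rfl fun k _ => ?_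
      simp [hK, kry, walk_diag]
    · intro i j hij
      have hij' : (j : ℕ) < i := hij
      simp only [hK, Matrix.of_apply, kry]
      rw [walk_zero_of_lt _ _ _ (by omega), mul_zero]
  have h3 : (Matrix.of U).det ^ 2 = 1 := by
    have : Matrix.of U * (Matrix.of U)ᵀ = 1 := by
      ext n m
      rw [Matrix.mul_apply]
      simp only [Matrix.transpose_apply, Matrix.of_apply, h.orth, Matrix.one_apply]
    have h4 := congrArg Matrix.det this
    rw [Matrix.det_mul, Matrix.det_transpose, Matrix.det_one] at h4
    rw [sq, h4]
  have h5 : K.det ^ 2 = vdm lam ^ 2 * ∏ l, U ⟨0, hN⟩ l ^ 2 := by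
    rw [h1, Matrix.det_mul, Matrix.det_mul, Matrix.det_diagonal, Matrix.det_vandermonde,
      Finset.prod_pow]
    unfold vdm
    rw [mul_pow, h3]; ring
  rw [← h5, h2, ← Finset.prod_pow]
  refine Finset.prod_congr rfl fun k _ => ?_
  rw [Real.sq_sqrt]
  exact Finset.prod_nonneg fun l _ => mul_nonneg (hξ _) (hξ _)

lemma det_eigData {N : ℕ} {J : Matrix (Fin N) (Fin N) ℝ} {U : Fin N → Fin N → ℝ}
    {lam : Fin N → ℝ} (h : EigData J U lam) (t s : ℝ) :
    (t • (1 : Matrix (Fin N) (Fin N) ℝ) + s • J).det = ∏ l, (t + s * lam l) := by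
  have h3 : Matrix.of U * (Matrix.of U)ᵀ = 1 := by
    ext n m
    rw [Matrix.mul_apply]
    simp only [Matrix.transpose_apply, Matrix.of_apply, h.orth, Matrix.one_apply]
  have h1 : (t • (1 : Matrix (Fin N) (Fin N) ℝ) + s • J) * Matrix.of U =
      Matrix.of U * Matrix.diagonal (fun l => t + s * lam l) := by
    have hJ : J * Matrix.of U = Matrix.of U * Matrix.diagonal lam := by
      ext n l
      rw [Matrix.mul_apply, Matrix.mul_diagonal]
      simp only [Matrix.of_apply, h.eig]; ring
    rw [Matrix.add_mul, Matrix.smul_mul, Matrix.smul_mul, Matrix.one_mul, hJ]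
    ext n l
    simp only [Matrix.add_apply, Matrix.smul_apply, Matrix.mul_diagonal, smul_eq_mul]
    ring
  have h4 := congrArg Matrix.det h3
  rw [Matrix.det_mul, Matrix.det_transpose, Matrix.det_one] at h4
  have h5 := congrArg Matrix.det h1
  rw [Matrix.det_mul, Matrix.det_mul, Matrix.det_diagonal] at h5
  have h6 : (Matrix.of U).det ≠ 0 := fun h => by rw [h] at h4; norm_num at h4
  rw [mul_comm] at h5
  exact mul_left_cancel₀ h6 h5

lemma eig_nonneg {N : ℕ} {J B : Matrix (Fin N) (Fin N) ℝ} {U : Fin N → Fin N → ℝ}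
    {lam : Fin N → ℝ} (h : EigData J U lam) (t s : ℝ)
    (hB : t • (1 : Matrix (Fin N) (Fin N) ℝ) + s • J = B * Bᵀ) (l : Fin N) : 0 ≤ t + s * lam l := by
  have h1 : ∀ n, ∑ m, (B * Bᵀ) n m * U m l = (t + s * lam l) * U n l := by
    intro n
    rw [← hB]
    simp only [Matrix.add_apply, Matrix.smul_apply, smul_eq_mul, add_mul, Finset.sum_add_distrib,
      mul_assoc, ← Finset.mul_sum, h.eig]
    simp [Matrix.one_apply]
  have h2 : ∑ n, U n l * ∑ m, (B * Bᵀ) n m * U m l = t + s * lam l := by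
    simp only [h1]
    have := h.orth' l l
    rw [if_pos rfl] at this
    calc _ = (t + s * lam l) * ∑ n, U n l * U n l := by
          rw [Finset.mul_sum]; exact Finset.sum_congr rfl fun n _ => by ring
      _ = _ := by rw [this, mul_one]
  have h3 : ∑ n, U n l * ∑ m, (B * Bᵀ) n m * U m l = ∑ r, (∑ n, U n l * B n r) ^ 2 := by
    simp only [Matrix.mul_apply, Matrix.transpose_apply, sq, Finset.sum_mul, Finset.mul_sum]
    conv_lhs =>
      enter [2, n]
      rw [Finset.sum_comm]
    rw [Finset.sum_comm]
    refine Finset.sum_congr rfl fun r _ => Finset.sum_congr rfl fun n _ =>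
      Finset.sum_congr rfl fun m _ => by ring
  rw [← h2, h3]
  exact Finset.sum_nonneg fun r _ => sq_nonneg _

lemma exists_spec_coord {N : ℕ} (x w : Fin N → ℝ) (hw : ∑ i, w i = 1) :
    ∃ p : Fin (2 * N - 1) → ℝ, xs p = x ∧ ws p = w := by
  refine ⟨fun k => if h : (k : ℕ) % 2 = 0 then x ⟨k / 2, by omega⟩ else w ⟨(k + 1) / 2, by omega⟩, ?_, ?_⟩
  · ext i
    simp only [xs]
    rw [ext0_lt _ (by omega)]
    simp
  · have hN : 0 < N := by
      rcases Nat.eq_zero_or_pos N with h | h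
      · subst h; simp at hw
      · exact h
    set p : Fin (2 * N - 1) → ℝ := fun k => if h : (k : ℕ) % 2 = 0 then x ⟨k / 2, by omega⟩
      else w ⟨(k + 1) / 2, by omega⟩ with hp
    have h1 : ∀ i : Fin N, (i : ℕ) ≠ 0 → ws p i = w i := by
      intro i hi
      simp only [ws, hi, if_false]
      rw [ext0_lt _ (by omega)]
      have e : ¬ ((2 * (i : ℕ) - 1) % 2 = 0) := by omega
      simp only [hp, e, dif_neg, not_false_eq_true]
      congr 1
      ext
      simp; omega
    ext i
    by_cases hi : (i : ℕ) = 0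
    · have h2 := sum_ws hN p
      have h3 : ∑ j, (ws p j - w j) = 0 := by rw [Finset.sum_sub_distrib, h2, hw, sub_self]
      rw [Finset.sum_eq_single i] at h3
      · linarith
      · intro j _ hj
        rw [h1 j (fun h => hj (Fin.ext (h.trans hi.symm))), sub_self]
      · simp
    · exact h1 i hi

lemma exists_eigData {N : ℕ} (hN : 0 < N) (a : Fin N → ℝ) (b : Fin (N - 1) → ℝ) :
    ∃ U, EigData (jacobiMatrix a b) U (jacobiEigs a b) := by
  set hA := jacobiMatrix_isHermitian a b
  set τ : Equiv.Perm (Fin N) := Fin.revPerm.trans (Tuple.sort hA.eigenvalues) with hτ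
  have hlam : ∀ l, jacobiEigs a b l = hA.eigenvalues (τ l) := fun l => rfl
  refine ⟨fun n l => hA.eigenvectorBasis (τ l) n, ?_, ?_, ?_⟩
  · intro n m
    have h1 : (hA.eigenvectorUnitary : Matrix (Fin N) (Fin N) ℝ) *
        star (hA.eigenvectorUnitary : Matrix (Fin N) (Fin N) ℝ) = 1 :=
      Unitary.coe_mul_star_self _
    have h2 := congrFun (congrFun h1 n) m
    rw [Matrix.mul_apply, Matrix.one_apply] at h2
    rw [← h2, ← Equiv.sum_comp τ (fun j => (hA.eigenvectorUnitary : Matrix (Fin N) (Fin N) ℝ) n j *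
      (star (hA.eigenvectorUnitary : Matrix (Fin N) (Fin N) ℝ)) j m)]
    refine Finset.sum_congr rfl fun l _ => ?_
    simp [Matrix.star_apply, Matrix.IsHermitian.eigenvectorUnitary_apply]
  · intro l m
    have h1 := orthonormal_iff_ite.1 hA.eigenvectorBasis.orthonormal (τ l) (τ m)
    simp only [EmbeddingLike.apply_eq_iff_eq] at h1
    rw [← h1, PiLp.inner_apply]
    refine Finset.sum_congr rfl fun n _ => ?_
    simp [mul_comm]
  · intro n l
    have h1 := congrFun (hA.mulVec_eigenvectorBasis (τ l)) n
    rw [hlam]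
    simpa [Matrix.mulVec, dotProduct] using h1

lemma jacobiEigs_antitone {N : ℕ} (a : Fin N → ℝ) (b : Fin (N - 1) → ℝ) {i j : Fin N} (hij : i ≤ j) :
    jacobiEigs a b j ≤ jacobiEigs a b i := by
  unfold jacobiEigs sortDesc
  exact Tuple.monotone_sort (jacobiMatrix_isHermitian a b).eigenvalues (Fin.rev_le_rev.2 hij)

/-- Identities between canonical moments and spectral data. -/
structure SpecRel {N : ℕ} (c p : Fin (2 * N - 1) → ℝ) : Prop where
  prodx : ∏ i, xs p i = ∏ n ∈ Finset.range N, chainSeq (ext0 c) (2 * n)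
  prodx1 : ∏ i, (1 - xs p i) = ∏ n ∈ Finset.range N, (prevC (ext0 c) (2 * n) * (1 - ext0 c (2 * n)))
  vd : vdm (xs p) ^ 2 * ∏ i, ws p i =
    ∏ k ∈ Finset.range N, ∏ l ∈ Finset.range k, bSeq (chainSeq (ext0 c)) l

lemma exists_spec {N : ℕ} (hN : 0 < N) {c : Fin (2 * N - 1) → ℝ} (hc : c ∈ cube (2 * N - 1)) :
    ∃ p ∈ specDom N, momG p = momF c ∧ xs p = jacobiEigs (xiToA (cToXi c)) (xiToB (cToXi c)) ∧
      SpecRel c p := by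
  obtain ⟨U, hU⟩ := exists_eigData hN (xiToA (cToXi c)) (xiToB (cToXi c))
  set x := jacobiEigs (xiToA (cToXi c)) (xiToB (cToXi c)) with hx
  set ξ := chainSeq (ext0 c) with hξdef
  have hξ : ∀ k, 0 ≤ ξ k := chainSeq_nonneg hc
  have hz : ξ (2 * N - 1) = 0 := by
    rw [hξdef, chainSeq_eq, ext0_ge c le_rfl, mul_zero]
  have hU' : EigData (triMat N (aSeq ξ) (fun n => √(bSeq ξ n))) U x := by
    rw [← jacC_eq]; exact hU
  have hmom : ∀ k, walk ξ (2 * k) 0 = ∑ l, U ⟨0, hN⟩ l ^ 2 * x l ^ k := by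
    intro k
    have := kry_spectral hN hξ hz hU' k ⟨0, hN⟩
    simp only [kry, Finset.range_zero, Finset.prod_empty, Real.sqrt_one, one_mul, mul_zero] at this
    rw [this]
    exact Finset.sum_congr rfl fun l _ => by ring
  have hw1 : ∑ l, U ⟨0, hN⟩ l ^ 2 = 1 := by
    have := hmom 0
    simp [walk] at this
    exact this.symm
  obtain ⟨p, hpx, hpw⟩ := exists_spec_coord x (fun l => U ⟨0, hN⟩ l ^ 2) hw1
  have hvd := vdm_weights hN hξ hz hU'
  have hvdpos : 0 < vdm x ^ 2 * ∏ l, U ⟨0, hN⟩ l ^ 2 := by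
    rw [hvd]
    refine Finset.prod_pos fun k hk => Finset.prod_pos fun l hl => ?_
    have hk := Finset.mem_range.1 hk
    have hl := Finset.mem_range.1 hl
    exact mul_pos (chainSeq_pos hc (by omega)) (chainSeq_pos hc (by omega))
  have hI1 : ∏ i, x i = ∏ n ∈ Finset.range N, ξ (2 * n) := by
    have h1 := det_eigData hU 0 1
    have h2 := jacC_fact hc
    simp only [jacC] at h2
    simp only [zero_smul, zero_add, one_smul, one_mul] at h1
    rw [← h1, h2, Matrix.det_mul, Matrix.det_transpose, det_biMat, ← Finset.prod_mul_distrib]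
    exact Finset.prod_congr rfl fun n _ => Real.mul_self_sqrt (hξ _)
  have hI2 : ∏ i, (1 - x i) = ∏ n ∈ Finset.range N, (prevC (ext0 c) (2 * n) * (1 - ext0 c (2 * n))) := by
    have h1 := det_eigData hU 1 (-1)
    have h2 := one_sub_jacC_fact hc
    simp only [jacC] at h2
    simp only [one_smul, neg_smul, neg_mul, one_mul, ← sub_eq_add_neg] at h1
    rw [← h1, h2, Matrix.det_mul, Matrix.det_transpose, det_biMat, ← Finset.prod_mul_distrib]
    exact Finset.prod_congr rfl fun n _ =>
      Real.mul_self_sqrt (mul_nonneg (prevC_nonneg hc _) (ext0_cube hc _).2)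
  have hI1pos : 0 < ∏ i, x i := by
    rw [hI1]
    exact Finset.prod_pos fun n hn => chainSeq_pos hc (by have := Finset.mem_range.1 hn; omega)
  have hI2pos : 0 < ∏ i, (1 - x i) := by
    rw [hI2]
    refine Finset.prod_pos fun n hn => ?_
    have := Finset.mem_range.1 hn
    exact mul_pos (prevC_pos hc (by omega)) (by linarith [(cube_ext hc (k := 2 * n) (by omega)).2])
  refine ⟨p, ⟨?_, ?_, ?_⟩, ?_, hpx, ⟨?_, ?_, ?_⟩⟩
  · intro i j hij
    rw [hpx]
    refine lt_of_le_of_ne (jacobiEigs_antitone _ _ hij.le) fun heq => ?_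
    have : vdm x = 0 := by
      unfold vdm
      exact Finset.prod_eq_zero (Finset.mem_univ i)
        (Finset.prod_eq_zero (Finset.mem_Ioi.2 hij) (sub_eq_zero.2 heq))
    rw [this] at hvdpos
    simp at hvdpos
  · intro i
    rw [hpx]
    have h1 : 0 ≤ x i := by
      have := eig_nonneg hU 0 1 (by
        rw [zero_smul, zero_add, one_smul]; exact jacC_fact hc) i
      linarith
    have h2 : 0 ≤ 1 - x i := by
      have := eig_nonneg hU 1 (-1) (by
        rw [one_smul, neg_one_smul, ← sub_eq_add_neg]; exact one_sub_jacC_fact hc) i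
      linarith
    have h3 : x i ≠ 0 := fun h => hI1pos.ne' (Finset.prod_eq_zero (Finset.mem_univ i) h)
    have h4 : 1 - x i ≠ 0 := fun h =>
      hI2pos.ne' (Finset.prod_eq_zero (f := fun i => 1 - x i) (Finset.mem_univ i) h)
    exact ⟨lt_of_le_of_ne h1 h3.symm, by linarith [lt_of_le_of_ne h2 h4.symm]⟩
  · intro i
    rw [hpw]
    have : U ⟨0, hN⟩ i ≠ 0 := by
      intro h
      have h0 : ∏ l, U ⟨0, hN⟩ l ^ 2 = 0 :=
        Finset.prod_eq_zero (Finset.mem_univ i) (by rw [h]; norm_num)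
      rw [h0] at hvdpos
      simp at hvdpos
    positivity
  · ext k
    unfold momG momF polInt
    rw [hpx, hpw, show 2 * (k : ℕ) + 2 = 2 * (k + 1) by ring, hmom]
    simp
  · rw [hpx, hI1]
  · rw [hpx, hI2]
  · rw [hpx, hpw]; exact hvd

lemma specRel_of {N : ℕ} (hN : 0 < N) {c p : Fin (2 * N - 1) → ℝ} (hc : c ∈ cube (2 * N - 1))
    (hp : p ∈ specDom N) (h : momG p = momF c) :
    SpecRel c p ∧ xs p = jacobiEigs (xiToA (cToXi c)) (xiToB (cToXi c)) := by
  obtain ⟨q, hq, h1, h2, h3⟩ := exists_spec hN hc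
  have : q = p := injOn_momG hN hq hp (h1.trans h.symm)
  subst this
  exact ⟨h3, h2⟩

lemma continuous_prevC {m : ℕ} (k : ℕ) : Continuous (fun c : Fin m → ℝ => prevC (ext0 c) k) := by
  unfold prevC
  split_ifs
  · exact continuous_const
  · exact continuous_const.sub (contDiff_ext0 _).continuous

lemma continuous_xs {N : ℕ} : Continuous (xs : (Fin (2 * N - 1) → ℝ) → Fin N → ℝ) :=
  continuous_pi fun i => (contDiff_xs i).continuous

lemma continuous_ws {N : ℕ} : Continuous (ws : (Fin (2 * N - 1) → ℝ) → Fin N → ℝ) :=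
  continuous_pi fun i => (contDiff_ws i).continuous

lemma continuous_vdm {N : ℕ} : Continuous (vdm : (Fin N → ℝ) → ℝ) := by
  unfold vdm
  fun_prop

lemma specRel_lim {N : ℕ} {u v : ℕ → (Fin (2 * N - 1) → ℝ)} {c p : Fin (2 * N - 1) → ℝ}
    (hu : Filter.Tendsto u Filter.atTop (nhds c)) (hv : Filter.Tendsto v Filter.atTop (nhds p))
    (h : ∀ n, SpecRel (u n) (v n)) : SpecRel c p := by
  have key : ∀ f g : (Fin (2 * N - 1) → ℝ) → ℝ, Continuous f → Continuous g →
      (∀ n, f (v n) = g (u n)) → f p = g c := by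
    intro f g hf hg hfg
    refine tendsto_nhds_unique ((hf.tendsto p).comp hv) ?_
    have : f ∘ v = g ∘ u := funext hfg
    rw [this]
    exact (hg.tendsto c).comp hu
  have hx := continuous_xs (N := N)
  have hw := continuous_ws (N := N)
  have hxi : ∀ i, Continuous fun p : Fin (2 * N - 1) → ℝ => xs p i := fun i => (contDiff_xs i).continuous
  have hwi : ∀ i, Continuous fun p : Fin (2 * N - 1) → ℝ => ws p i := fun i => (contDiff_ws i).continuous
  refine ⟨?_, ?_, ?_⟩
  · exact key (fun p => ∏ i, xs p i) (fun c => ∏ n ∈ Finset.range N, chainSeq (ext0 c) (2 * n))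
      (continuous_finset_prod _ fun i _ => hxi i)
      (continuous_finset_prod _ fun i _ => (contDiff_chainSeq _).continuous) fun n => (h n).prodx
  · exact key (fun p => ∏ i, (1 - xs p i))
      (fun c => ∏ n ∈ Finset.range N, (prevC (ext0 c) (2 * n) * (1 - ext0 c (2 * n))))
      (continuous_finset_prod _ fun i _ => continuous_const.sub (hxi i))
      (continuous_finset_prod _ fun i _ => (continuous_prevC _).mul
        (continuous_const.sub (contDiff_ext0 _).continuous)) fun n => (h n).prodx1
  · exact key (fun p => vdm (xs p) ^ 2 * ∏ i, ws p i)
      (fun c => ∏ k ∈ Finset.range N, ∏ l ∈ Finset.range k, bSeq (chainSeq (ext0 c)) l)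
      (((continuous_vdm.comp hx).pow 2).mul (continuous_finset_prod _ fun i _ => hwi i))
      (continuous_finset_prod _ fun i _ => continuous_finset_prod _ fun j _ =>
        (contDiff_chainSeq _).continuous.mul (contDiff_chainSeq _).continuous) fun n => (h n).vd

lemma vdm_ne_zero {N : ℕ} {x : Fin N → ℝ} (h : ∀ i j, i < j → x j < x i) : vdm x ≠ 0 := by
  unfold vdm
  refine Finset.prod_ne_zero_iff.2 fun i _ => Finset.prod_ne_zero_iff.2 fun j hj => ?_
  have := h i j (Finset.mem_Ioi.1 hj)
  linarith

lemma cube_of_specRel {N : ℕ} (hN : 2 ≤ N) {c p : Fin (2 * N - 1) → ℝ}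
    (hc : ∀ i, c i ∈ Set.Icc (0 : ℝ) 1) (hp : p ∈ specDom N) (h : SpecRel c p) :
    c ∈ cube (2 * N - 1) := by
  obtain ⟨hp1, hp2, hp3⟩ := hp
  have e1 : ∏ n ∈ Finset.range N, chainSeq (ext0 c) (2 * n) ≠ 0 := by
    rw [← h.prodx]; exact Finset.prod_ne_zero_iff.2 fun i _ => (hp2 i).1.ne'
  have e2 : ∏ n ∈ Finset.range N, (prevC (ext0 c) (2 * n) * (1 - ext0 c (2 * n))) ≠ 0 := by
    rw [← h.prodx1]; exact Finset.prod_ne_zero_iff.2 fun i _ => by linarith [(hp2 i).2]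
  have e3 : ∏ k ∈ Finset.range N, ∏ l ∈ Finset.range k, bSeq (chainSeq (ext0 c)) l ≠ 0 := by
    rw [← h.vd]
    exact mul_ne_zero (pow_ne_zero _ (vdm_ne_zero hp1)) (Finset.prod_ne_zero_iff.2 fun i _ => (hp3 i).ne')
  rw [Finset.prod_ne_zero_iff] at e1 e2 e3
  have f0 : ∀ k < 2 * N - 1, chainSeq (ext0 c) k ≠ 0 := by
    intro k hk
    obtain ⟨n, rfl | rfl⟩ := Nat.even_or_odd' k
    · exact e1 n (by simp; omega)
    · have := e3 (N - 1) (by simp; omega)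
      rw [Finset.prod_ne_zero_iff] at this
      exact right_ne_zero_of_mul (this n (by simp; omega))
  have f1 : ∀ k < 2 * N - 1, 1 - ext0 c k ≠ 0 := by
    intro k hk
    obtain ⟨n, rfl | rfl⟩ := Nat.even_or_odd' k
    · exact right_ne_zero_of_mul (e2 n (by simp; omega))
    · have := left_ne_zero_of_mul (e2 (n + 1) (by simp; omega))
      simpa [prevC, show 2 * (n + 1) ≠ 0 by omega, show 2 * (n + 1) - 1 = 2 * n + 1 by omega] using this
  intro i
  have g0 := f0 i i.2
  have g1 := f1 i i.2
  rw [chainSeq_eq] at g0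
  have g0 := right_ne_zero_of_mul g0
  rw [ext0_fin] at g0 g1
  exact ⟨lt_of_le_of_ne (hc i).1 g0.symm, lt_of_le_of_ne (hc i).2 fun h => g1 (by rw [h, sub_self])⟩

lemma image_eq {N : ℕ} (hN : 2 ≤ N) : momF '' cube (2 * N - 1) = momG '' specDom N := by
  have hN0 : 0 < N := by omega
  apply Set.Subset.antisymm
  · rintro _ ⟨c, hc, rfl⟩
    obtain ⟨p, hp, h, -⟩ := exists_spec hN0 hc
    exact ⟨p, hp, h⟩
  · have hcont : Continuous (momG : (Fin (2 * N - 1) → ℝ) → (Fin (2 * N - 1) → ℝ)) :=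
      contDiff_momG.continuous
    have hopen : IsOpen (momG ⁻¹' (momF '' cube (2 * N - 1)) ∩ specDom N) :=
      ((isOpen_momF_image _).preimage hcont).inter (isOpen_specDom N)
    have hsub : specDom N ⊆ momG ⁻¹' (momF '' cube (2 * N - 1)) ∩ specDom N := by
      refine IsPreconnected.subset_of_closure_inter_subset (convex_specDom N).isPreconnected hopen ?_ ?_
      · have hc : (fun _ => 1 / 2 : Fin (2 * N - 1) → ℝ) ∈ cube (2 * N - 1) := by
          intro i; constructor <;> norm_num
        obtain ⟨p, hp, h, -⟩ := exists_spec hN0 hc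
        exact ⟨p, hp, ⟨⟨_, hc, h.symm⟩, hp⟩⟩
      · rintro p ⟨hpc, hp⟩
        refine ⟨?_, hp⟩
        rw [mem_closure_iff_seq_limit] at hpc
        obtain ⟨v, hv, hvp⟩ := hpc
        choose c hc hcv using fun n => (hv n).1
        have hK : IsCompact (Set.pi Set.univ fun _ : Fin (2 * N - 1) => Set.Icc (0 : ℝ) 1) :=
          isCompact_univ_pi fun _ => isCompact_Icc
        obtain ⟨d, hd, φ, hφ, hlim⟩ := hK.tendsto_subseq (x := c) fun n i _ =>
          Set.Ioo_subset_Icc_self (hc n i)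
        have hvl := hvp.comp hφ.tendsto_atTop
        have hrel : SpecRel d p := specRel_lim hlim hvl fun n =>
          (specRel_of hN0 (hc _) (hv _).2 (hcv _).symm).1
        have hdc : d ∈ cube (2 * N - 1) := cube_of_specRel hN (fun i => hd i trivial) hp hrel
        refine ⟨d, hdc, ?_⟩
        refine tendsto_nhds_unique ((contDiff_momF.continuous.tendsto d).comp hlim) ?_
        have : (momF ∘ c ∘ φ) = momG ∘ v ∘ φ := funext fun n => hcv _
        rw [this]
        exact (hcont.tendsto p).comp hvl
    rintro _ ⟨p, hp, rfl⟩
    exact (hsub hp).1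

lemma log_identity (β a b : ℝ) (u v pv l : ℕ → ℝ) (hpv0 : pv 0 = 0) (hpv : ∀ k, pv (k + 1) = v k)
    (hl : ∀ k, l k = pv k + u k) (M : ℕ) :
    ∑ i ∈ Finset.range (2 * M + 1), (if i % 2 = 0 then
        (β / 2 * (((M : ℝ) + 1) - ((i : ℝ) / 2 + 1)) + a - 1) * u i +
        (β / 2 * (((M : ℝ) + 1) - ((i : ℝ) / 2 + 1)) + b - 1) * v i
      else (β / 2 * (((M : ℝ) + 1) - (((i : ℝ) - 1) / 2 + 1)) - 1) * u i +
        (β / 2 * (((M : ℝ) + 1) - (((i : ℝ) - 1) / 2 + 1) - 1) + a + b - 1) * v i)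
      + 2 * ∑ k ∈ Finset.range (M + 1), ∑ j ∈ Finset.range k, (l (2 * j) + l (2 * j + 1))
    = ∑ k ∈ Finset.range (2 * M + 1), (pv k + ∑ i ∈ Finset.range k, l i)
      + β / 2 * ∑ k ∈ Finset.range (M + 1), ∑ j ∈ Finset.range k, (l (2 * j) + l (2 * j + 1))
      + (a - 1) * ∑ n ∈ Finset.range (M + 1), l (2 * n)
      + (b - 1) * ∑ n ∈ Finset.range (M + 1), (pv (2 * n) + v (2 * n)) := by
  have hT : ∀ k, ∑ i ∈ Finset.range (k + 1), l i = ∑ i ∈ Finset.range k, (u i + v i) + u k := by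
    intro k
    induction k with
    | zero => simp [hl, hpv0]
    | succ k ih => rw [Finset.sum_range_succ, ih, Finset.sum_range_succ _ k, hl, hpv]; ring
  have hB : ∀ k, ∑ j ∈ Finset.range k, (l (2 * j) + l (2 * j + 1)) = ∑ i ∈ Finset.range (2 * k), l i := by
    intro k
    induction k with
    | zero => simp
    | succ k ih => rw [Finset.sum_range_succ, ih, show 2 * (k + 1) = 2 * k + 1 + 1 by ring,
        Finset.sum_range_succ, Finset.sum_range_succ]; ring
  simp only [hB]
  induction M with
  | zero => simp [hl, hpv0]
  | succ M ih =>
    rw [show 2 * (M + 1) + 1 = 2 * M + 1 + 1 + 1 by ring]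
    simp only [Finset.sum_range_succ _ (2 * M + 1 + 1), Finset.sum_range_succ _ (2 * M + 1),
      Finset.sum_range_succ _ (M + 1)]
    rw [show 2 * (M + 1) = 2 * M + 1 + 1 by ring] 
    have h1 : (2 * M + 1) % 2 = 1 := by omega
    have h2 : (2 * M + 1 + 1) % 2 = 0 := by omega
    rw [h1, h2]
    have h3 : ∀ i ∈ Finset.range (2 * M + 1), (if i % 2 = 0 then
        (β / 2 * ((((M + 1 : ℕ) : ℝ) + 1) - ((i : ℝ) / 2 + 1)) + a - 1) * u i +
        (β / 2 * ((((M + 1 : ℕ) : ℝ) + 1) - ((i : ℝ) / 2 + 1)) + b - 1) * v i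
      else (β / 2 * ((((M + 1 : ℕ) : ℝ) + 1) - (((i : ℝ) - 1) / 2 + 1)) - 1) * u i +
        (β / 2 * ((((M + 1 : ℕ) : ℝ) + 1) - (((i : ℝ) - 1) / 2 + 1) - 1) + a + b - 1) * v i)
      = (if i % 2 = 0 then
        (β / 2 * (((M : ℝ) + 1) - ((i : ℝ) / 2 + 1)) + a - 1) * u i +
        (β / 2 * (((M : ℝ) + 1) - ((i : ℝ) / 2 + 1)) + b - 1) * v i
      else (β / 2 * (((M : ℝ) + 1) - (((i : ℝ) - 1) / 2 + 1)) - 1) * u i +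
        (β / 2 * (((M : ℝ) + 1) - (((i : ℝ) - 1) / 2 + 1) - 1) + a + b - 1) * v i)
        + β / 2 * (u i + v i) := by
      intro i _
      push_cast
      split_ifs <;> ring
    rw [Finset.sum_congr rfl h3, Finset.sum_add_distrib, ← Finset.mul_sum]
    have t1 := hT (2 * M)
    have t2 := hT (2 * M + 1)
    have t3 := hl (2 * M + 1)
    have t4 := hl (2 * M + 1 + 1)
    have t5 : ∑ i ∈ Finset.range (2 * M + 1), (u i + v i) = _ := Finset.sum_range_succ _ (2 * M)
    have t6 : ∑ i ∈ Finset.range (2 * M + 1 + 1), l i = _ := Finset.sum_range_succ _ (2 * M + 1)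
    rw [hpv] at t3 t4
    simp only [hpv, if_true, one_ne_zero, if_false]
    rw [t4, t3, t1, t5, t6]
    rw [t2, t5] at t6
    rw [t1, t3]
    push_cast
    linear_combination ih

/-- Beta density exponents: product of power densities. -/
def powDens (β a b : ℝ) (N i : ℕ) (t : ℝ) : ℝ :=
  if i % 2 = 0 then
    t ^ (β / 2 * ((N : ℝ) - ((i : ℝ) / 2 + 1)) + a - 1) *
      (1 - t) ^ (β / 2 * ((N : ℝ) - ((i : ℝ) / 2 + 1)) + b - 1)
  else t ^ (β / 2 * ((N : ℝ) - (((i : ℝ) - 1) / 2 + 1)) - 1) *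
      (1 - t) ^ (β / 2 * ((N : ℝ) - (((i : ℝ) - 1) / 2 + 1) - 1) + a + b - 1)

lemma powDens_pos (β a b : ℝ) (N i : ℕ) {t : ℝ} (ht : t ∈ Set.Ioo (0 : ℝ) 1) : 0 < powDens β a b N i t := by
  have h1 := ht.1
  have h2 : 0 < 1 - t := by linarith [ht.2]
  unfold powDens
  split_ifs <;> positivity

lemma log_powDens (β a b : ℝ) (N i : ℕ) {t : ℝ} (ht : t ∈ Set.Ioo (0 : ℝ) 1) :
    Real.log (powDens β a b N i t) = if i % 2 = 0 then
        (β / 2 * ((N : ℝ) - ((i : ℝ) / 2 + 1)) + a - 1) * Real.log t +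
        (β / 2 * ((N : ℝ) - ((i : ℝ) / 2 + 1)) + b - 1) * Real.log (1 - t)
      else (β / 2 * ((N : ℝ) - (((i : ℝ) - 1) / 2 + 1)) - 1) * Real.log t +
        (β / 2 * ((N : ℝ) - (((i : ℝ) - 1) / 2 + 1) - 1) + a + b - 1) * Real.log (1 - t) := by
  have h1 := ht.1
  have h2 : 0 < 1 - t := by linarith [ht.2]
  unfold powDens
  split_ifs
  all_goals
    rw [Real.log_mul (Real.rpow_pos_of_pos h1 _).ne' (Real.rpow_pos_of_pos h2 _).ne',
      Real.log_rpow h1, Real.log_rpow h2]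

lemma density_identity {N : ℕ} (hN : 0 < N) (β a b : ℝ) {c p : Fin (2 * N - 1) → ℝ}
    (hc : c ∈ cube (2 * N - 1)) (hp : p ∈ specDom N) (h : SpecRel c p) :
    (∏ i : Fin (2 * N - 1), powDens β a b N i (c i)) * |(∏ i, ws p i) * vdm (xs p) ^ 4| =
      jacF c * ((|vdm (xs p)| ^ β * ∏ n, (xs p n ^ (a - 1) * (1 - xs p n) ^ (b - 1))) *
        ∏ n, ws p n ^ (β / 2 - 1)) := by
  obtain ⟨hp1, hp2, hp3⟩ := hp
  have hV : 0 < |vdm (xs p)| := abs_pos.2 (vdm_ne_zero hp1)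
  have hW : 0 < ∏ i, ws p i := Finset.prod_pos fun i _ => hp3 i
  have hx1 : ∀ i, 0 < 1 - xs p i := fun i => by linarith [(hp2 i).2]
  have hx0 : ∀ i, 0 < xs p i := fun i => (hp2 i).1
  have hD : ∀ i : Fin (2 * N - 1), 0 < powDens β a b N i (c i) := fun i => powDens_pos _ _ _ _ _ (hc i)
  have hA : |(∏ i, ws p i) * vdm (xs p) ^ 4| = (∏ i, ws p i) * |vdm (xs p)| ^ 4 := by
    rw [abs_mul, abs_of_pos hW, abs_pow]
  have hJ := jacF_pos hc
  have hX : 0 < ∏ n, (xs p n ^ (a - 1) * (1 - xs p n) ^ (b - 1)) := Finset.prod_pos fun i _ =>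
    mul_pos (Real.rpow_pos_of_pos (hx0 i) _) (Real.rpow_pos_of_pos (hx1 i) _)
  have hWp : 0 < ∏ n, ws p n ^ (β / 2 - 1) := Finset.prod_pos fun i _ => Real.rpow_pos_of_pos (hp3 i) _
  have hDp : 0 < ∏ i : Fin (2 * N - 1), powDens β a b N i (c i) := Finset.prod_pos fun i _ => hD i
  rw [hA]
  refine Real.log_injOn_pos (Set.mem_Ioi.2 (by positivity)) (Set.mem_Ioi.2 (by positivity)) ?_
  rw [Real.log_mul hDp.ne' (by positivity), Real.log_mul hW.ne' (by positivity),
    Real.log_mul hJ.ne' (by positivity), Real.log_mul (by positivity) hWp.ne',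
    Real.log_mul (by positivity) hX.ne', Real.log_rpow hV, Real.log_pow,
    Real.log_prod (fun i _ => (hD i).ne'), Real.log_prod (fun i _ => (hp3 i).ne'),
    Real.log_prod (fun i _ => (mul_pos (Real.rpow_pos_of_pos (hx0 i) _) (Real.rpow_pos_of_pos (hx1 i) _)).ne'),
    Real.log_prod (fun i _ => (Real.rpow_pos_of_pos (hp3 i) _).ne')]
  simp only [fun i => Real.log_mul (Real.rpow_pos_of_pos (hx0 i) (a - 1)).ne' (Real.rpow_pos_of_pos (hx1 i) (b - 1)).ne',
    fun i => Real.log_rpow (hx0 i), fun i => Real.log_rpow (hx1 i), fun i => Real.log_rpow (hp3 i),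
    Finset.sum_add_distrib, ← Finset.mul_sum]
  obtain ⟨M, rfl⟩ : ∃ M, N = M + 1 := ⟨N - 1, by omega⟩
  have hm : 2 * (M + 1) - 1 = 2 * M + 1 := by omega
  set u : ℕ → ℝ := fun k => Real.log (ext0 c k) with hu
  set v : ℕ → ℝ := fun k => Real.log (1 - ext0 c k) with hv
  set pv : ℕ → ℝ := fun k => Real.log (prevC (ext0 c) k) with hpv
  set l : ℕ → ℝ := fun k => pv k + u k with hl
  have hlog : ∀ k < 2 * M + 1, Real.log (chainSeq (ext0 c) k) = l k := by
    intro k hk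
    rw [chainSeq_eq, Real.log_mul (prevC_pos hc (by omega)).ne' (cube_ext hc (by omega)).1.ne']
  have h1x := congrArg Real.log h.prodx
  have h2x := congrArg Real.log h.prodx1
  have h3x := congrArg Real.log h.vd
  rw [Real.log_prod (fun i _ => (hx0 i).ne'), Real.log_prod (fun n hn =>
    (chainSeq_pos hc (by have := Finset.mem_range.1 hn; omega)).ne')] at h1x
  rw [Real.log_prod (fun i _ => (hx1 i).ne'), Real.log_prod (fun n hn => by
    have := Finset.mem_range.1 hn
    exact (mul_pos (prevC_pos hc (by omega)) (by linarith [(cube_ext hc (k := 2 * n) (by omega)).2])).ne')] at h2x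
  have hb : ∀ k ∈ Finset.range (M + 1), ∀ j ∈ Finset.range k, 0 < bSeq (chainSeq (ext0 c)) j := by
    intro k hk j hj
    have hk := Finset.mem_range.1 hk
    have hj := Finset.mem_range.1 hj
    exact mul_pos (chainSeq_pos hc (by omega)) (chainSeq_pos hc (by omega))
  rw [← sq_abs, Real.log_mul (by positivity) hW.ne', Real.log_pow,
    Real.log_prod (fun i _ => (hp3 i).ne'),
    Real.log_prod (fun k hk => (Finset.prod_pos (hb k hk)).ne')] at h3x
  have e1 : ∑ n ∈ Finset.range (M + 1), Real.log (chainSeq (ext0 c) (2 * n)) =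
      ∑ n ∈ Finset.range (M + 1), l (2 * n) := Finset.sum_congr rfl fun n hn => by
    have := Finset.mem_range.1 hn
    exact hlog _ (by omega)
  have e2 : ∑ n ∈ Finset.range (M + 1), Real.log (prevC (ext0 c) (2 * n) * (1 - ext0 c (2 * n))) =
      ∑ n ∈ Finset.range (M + 1), (pv (2 * n) + v (2 * n)) := Finset.sum_congr rfl fun n hn => by
    have := Finset.mem_range.1 hn
    rw [Real.log_mul (prevC_pos hc (by omega)).ne' (by linarith [(cube_ext hc (k := 2 * n) (by omega)).2])]
  have e3 : ∑ k ∈ Finset.range (M + 1), Real.log (∏ j ∈ Finset.range k, bSeq (chainSeq (ext0 c)) j) =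
      ∑ k ∈ Finset.range (M + 1), ∑ j ∈ Finset.range k, (l (2 * j) + l (2 * j + 1)) :=
    Finset.sum_congr rfl fun k hk => by
      rw [Real.log_prod (fun j hj => (hb k hk j hj).ne')]
      refine Finset.sum_congr rfl fun j hj => ?_
      have hk := Finset.mem_range.1 hk
      have hj := Finset.mem_range.1 hj
      rw [bSeq, Real.log_mul (chainSeq_pos hc (by omega)).ne' (chainSeq_pos hc (by omega)).ne',
        hlog _ (by omega), hlog _ (by omega)]
  have e4 : Real.log (jacF c) = ∑ k ∈ Finset.range (2 * M + 1), (pv k + ∑ i ∈ Finset.range k, l i) := by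
    rw [jacF, Real.log_prod (fun k _ => (facF_pos hc k).ne'), ← hm,
      ← Fin.sum_univ_eq_sum_range (fun k => pv k + ∑ i ∈ Finset.range k, l i)]
    refine Finset.sum_congr rfl fun k _ => ?_
    have hpos : ∀ i ∈ Finset.range (k : ℕ), 0 < chainSeq (ext0 c) i := fun i hi =>
      chainSeq_pos hc (by have := Finset.mem_range.1 hi; omega)
    rw [Real.log_mul (prevC_pos hc k.2.le).ne' (Finset.prod_pos hpos).ne',
      Real.log_prod (fun i hi => (hpos i hi).ne')]
    congr 1
    refine Finset.sum_congr rfl fun i hi => ?_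
    have := Finset.mem_range.1 hi
    exact hlog _ (by omega)
  have e5 : ∑ i : Fin (2 * (M + 1) - 1), Real.log (powDens β a b (M + 1) i (c i)) =
      ∑ i ∈ Finset.range (2 * M + 1), (if i % 2 = 0 then
        (β / 2 * (((M : ℝ) + 1) - ((i : ℝ) / 2 + 1)) + a - 1) * u i +
        (β / 2 * (((M : ℝ) + 1) - ((i : ℝ) / 2 + 1)) + b - 1) * v i
      else (β / 2 * (((M : ℝ) + 1) - (((i : ℝ) - 1) / 2 + 1)) - 1) * u i +
        (β / 2 * (((M : ℝ) + 1) - (((i : ℝ) - 1) / 2 + 1) - 1) + a + b - 1) * v i) := by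
    rw [← hm, ← Fin.sum_univ_eq_sum_range (fun i => (if i % 2 = 0 then
        (β / 2 * (((M : ℝ) + 1) - ((i : ℝ) / 2 + 1)) + a - 1) * u i +
        (β / 2 * (((M : ℝ) + 1) - ((i : ℝ) / 2 + 1)) + b - 1) * v i
      else (β / 2 * (((M : ℝ) + 1) - (((i : ℝ) - 1) / 2 + 1)) - 1) * u i +
        (β / 2 * (((M : ℝ) + 1) - (((i : ℝ) - 1) / 2 + 1) - 1) + a + b - 1) * v i))]
    refine Finset.sum_congr rfl fun i _ => ?_
    rw [log_powDens _ _ _ _ _ (hc i)]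
    simp only [hu, hv, ext0_fin]
    push_cast
    rfl
  have key := log_identity β a b u v pv l (by simp [hpv, prevC]) (by intro k; simp [hpv, hv, prevC])
    (fun k => rfl) M
  rw [e1] at h1x
  rw [e2] at h2x
  rw [e3] at h3x
  rw [← e4, ← e5, ← h1x, ← h2x, ← h3x] at key
  push_cast at key ⊢
  linear_combination key

lemma lintegral_pi_prod : ∀ (n : ℕ) (g : Fin n → ℝ → ℝ≥0∞), (∀ i, Measurable (g i)) →
    ∫⁻ c : Fin n → ℝ, ∏ i, g i (c i) = ∏ i, ∫⁻ t, g i t := by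
  intro n
  induction n with
  | zero => intro g _; simp [volume_pi, Measure.pi_univ]
  | succ n ih =>
    intro g hg
    have hmp := volume_preserving_piFinSuccAbove (fun _ : Fin (n + 1) => ℝ) 0
    have hm2 : Measurable fun y : Fin n → ℝ => ∏ i, g i.succ (y i) :=
      Finset.measurable_fun_prod _ fun i _ => (hg _).comp (measurable_pi_apply i)
    have h1 : ∫⁻ c : Fin (n + 1) → ℝ, ∏ i, g i (c i) =
        ∫⁻ z : ℝ × (Fin n → ℝ), g 0 z.1 * ∏ i, g i.succ (z.2 i) := by
      rw [← hmp.lintegral_comp_emb (MeasurableEquiv.measurableEmbedding _)]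
      refine lintegral_congr fun c => ?_
      rw [Fin.prod_univ_succ]
      rfl
    rw [h1, Fin.prod_univ_succ, ← ih _ fun i => hg _]
    exact lintegral_prod_mul (hg 0).aemeasurable hm2.aemeasurable

lemma pi_withDensity {n : ℕ} (f : Fin n → ℝ → ℝ≥0∞) (hf : ∀ i, Measurable (f i))
    (hs : ∀ i, SigmaFinite ((volume : Measure ℝ).withDensity (f i))) :
    Measure.pi (fun i => (volume : Measure ℝ).withDensity (f i)) =
      (volume : Measure (Fin n → ℝ)).withDensity (fun c => ∏ i, f i (c i)) := by
  refine Measure.pi_eq fun s hs => ?_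
  rw [withDensity_apply _ (MeasurableSet.univ_pi hs), ← lintegral_indicator (MeasurableSet.univ_pi hs)]
  have : ∀ c : Fin n → ℝ, (Set.pi Set.univ s).indicator (fun c => ∏ i, f i (c i)) c =
      ∏ i, (s i).indicator (f i) (c i) := by
    intro c
    by_cases hc : c ∈ Set.pi Set.univ s
    · rw [Set.indicator_of_mem hc]
      exact Finset.prod_congr rfl fun i _ => (Set.indicator_of_mem (hc i trivial) _).symm
    · rw [Set.indicator_of_notMem hc]
      simp only [Set.mem_pi, not_forall] at hc
      obtain ⟨i, _, hi⟩ := hc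
      exact (Finset.prod_eq_zero (Finset.mem_univ i) (Set.indicator_of_notMem hi _)).symm
  simp only [this]
  rw [lintegral_pi_prod _ _ fun i => (hf i).indicator (hs i)]
  exact Finset.prod_congr rfl fun i _ => by
    rw [withDensity_apply _ (hs i), lintegral_indicator (hs i)]

/-- Odd coordinates. -/
def ys {N : ℕ} (p : Fin (2 * N - 1) → ℝ) : Fin (N - 1) → ℝ := fun l => ext0 p (2 * l + 1)

/-- Even and odd indices. -/
def splitFun (N : ℕ) : Fin N ⊕ Fin (N - 1) → Fin (2 * N - 1)
  | Sum.inl i => ⟨2 * i, by omega⟩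
  | Sum.inr l => ⟨2 * l + 1, by omega⟩

lemma splitFun_bij {N : ℕ} (hN : 0 < N) : Function.Bijective (splitFun N) := by
  rw [Fintype.bijective_iff_injective_and_card]
  constructor
  · rintro (i | i) (j | j) h <;> simp [splitFun, Fin.ext_iff] at h ⊢ <;> omega
  · simp; omega

lemma measurePreserving_split {N : ℕ} (hN : 0 < N) :
    MeasurePreserving (fun p : Fin (2 * N - 1) → ℝ => (xs p, ys p)) volume volume := by
  have h1 := volume_measurePreserving_piCongrLeft (fun _ : Fin (2 * N - 1) => ℝ)
    (Equiv.ofBijective _ (splitFun_bij hN))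
  have h2 := volume_measurePreserving_sumPiEquivProdPi (fun _ : Fin N ⊕ Fin (N - 1) => ℝ)
  have h3 := h2.comp h1.symm
  convert h3 using 1
  ext p i
  · have : 2 * (i : ℕ) < 2 * N - 1 := by omega
    simp [xs, ext0_lt _ this]
    rfl
  · have : 2 * (i : ℕ) + 1 < 2 * N - 1 := by omega
    simp [ys, ext0_lt _ this]
    rfl

lemma lintegral_split {N : ℕ} (hN : 0 < N) {Φ : (Fin N → ℝ) → ℝ≥0∞} {Ψ : (Fin (N - 1) → ℝ) → ℝ≥0∞}
    (hΦ : Measurable Φ) (hΨ : Measurable Ψ) :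
    ∫⁻ p : Fin (2 * N - 1) → ℝ, Φ (xs p) * Ψ (ys p) = (∫⁻ x, Φ x) * ∫⁻ y, Ψ y := by
  have h := (measurePreserving_split hN).lintegral_comp (f := fun z => Φ z.1 * Ψ z.2)
    ((hΦ.comp measurable_fst).mul (hΨ.comp measurable_snd))
  rw [h]
  exact lintegral_prod_mul hΦ.aemeasurable hΨ.aemeasurable

/-- Weights as a function of the odd coordinates. -/
def wfun {N : ℕ} (y : Fin (N - 1) → ℝ) : Fin N → ℝ := fun i =>
  if (i : ℕ) = 0 then 1 - ∑ l, y l else ext0 y (i - 1)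

lemma ws_eq {N : ℕ} (p : Fin (2 * N - 1) → ℝ) : ws p = wfun (ys p) := by
  ext i
  unfold ws wfun
  split_ifs with h
  · rw [← Fin.sum_univ_eq_sum_range (fun l => ext0 p (2 * l + 1))]
    rfl
  · rw [ext0_lt (ys p) (show (i : ℕ) - 1 < N - 1 by omega), ys]
    congr 1
    simp; omega

lemma measurable_wfun {N : ℕ} (i : Fin N) : Measurable fun y : Fin (N - 1) → ℝ => wfun y i := by
  unfold wfun
  split_ifs
  · fun_prop
  · exact (contDiff_ext0 _).continuous.measurable

/-- Normalizing constants of the Beta densities. -/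
def betaK (β a b : ℝ) (N i : ℕ) : ℝ :=
  if i % 2 = 0 then
    Real.Gamma ((β / 2 * ((N : ℝ) - ((i : ℝ) / 2 + 1)) + a) + (β / 2 * ((N : ℝ) - ((i : ℝ) / 2 + 1)) + b)) /
      (Real.Gamma (β / 2 * ((N : ℝ) - ((i : ℝ) / 2 + 1)) + a) *
        Real.Gamma (β / 2 * ((N : ℝ) - ((i : ℝ) / 2 + 1)) + b))
  else
    Real.Gamma ((β / 2 * ((N : ℝ) - (((i : ℝ) - 1) / 2 + 1))) +
        (β / 2 * ((N : ℝ) - (((i : ℝ) - 1) / 2 + 1) - 1) + a + b)) /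
      (Real.Gamma (β / 2 * ((N : ℝ) - (((i : ℝ) - 1) / 2 + 1))) *
        Real.Gamma (β / 2 * ((N : ℝ) - (((i : ℝ) - 1) / 2 + 1) - 1) + a + b))

/-- The Beta densities. -/
def betaD (β a b : ℝ) (N i : ℕ) (t : ℝ) : ℝ≥0∞ :=
  ENNReal.ofReal ((Set.Ioo (0 : ℝ) 1).indicator (fun t => betaK β a b N i * powDens β a b N i t) t)

/-- The Beta measures. -/
def betaMM (β a b : ℝ) (N i : ℕ) : Measure ℝ :=
  if i % 2 = 0 then
    betaM (β / 2 * ((N : ℝ) - ((i : ℝ) / 2 + 1)) + a)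
          (β / 2 * ((N : ℝ) - ((i : ℝ) / 2 + 1)) + b)
  else
    betaM (β / 2 * ((N : ℝ) - (((i : ℝ) - 1) / 2 + 1)))
          (β / 2 * ((N : ℝ) - (((i : ℝ) - 1) / 2 + 1) - 1) + a + b)

lemma betaMM_eq (β a b : ℝ) (N i : ℕ) : betaMM β a b N i = volume.withDensity (betaD β a b N i) := by
  unfold betaMM betaD betaK powDens betaM
  split_ifs
  all_goals
    congr 1
    ext t
    simp only [mul_assoc]

lemma betaM_prob {α γ : ℝ} (hα : 0 < α) (hγ : 0 < γ) : IsProbabilityMeasure (betaM α γ) := by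
  have : betaM α γ = betaMeasure α γ := by
    unfold betaM betaMeasure
    congr 1
    ext t
    rw [betaPDF_eq]
    congr 1
    by_cases h : 0 < t ∧ t < 1
    · rw [if_pos h, Set.indicator_of_mem (show t ∈ Set.Ioo (0 : ℝ) 1 from h), ProbabilityTheory.beta, one_div_div]
    · rw [if_neg h, Set.indicator_of_notMem (show t ∉ Set.Ioo (0 : ℝ) 1 from h)]
  rw [this]
  exact isProbabilityMeasureBeta hα hγ

lemma param_even {N : ℕ} (hN : 0 < N) {β a : ℝ} (hβ : 0 < β) (ha : 0 < a) (i : Fin (2 * N - 1)) :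
    0 < β / 2 * ((N : ℝ) - (((i : ℕ) : ℝ) / 2 + 1)) + a := by
  have h1 : ((i : ℕ) : ℝ) + 2 ≤ 2 * N := by
    have := i.2
    exact_mod_cast (show (i : ℕ) + 2 ≤ 2 * N by omega)
  have : 0 ≤ (N : ℝ) - (((i : ℕ) : ℝ) / 2 + 1) := by linarith
  positivity

lemma param_odd1 {N : ℕ} {β : ℝ} (hβ : 0 < β) (i : Fin (2 * N - 1)) (hi : (i : ℕ) % 2 ≠ 0) :
    0 < β / 2 * ((N : ℝ) - ((((i : ℕ) : ℝ) - 1) / 2 + 1)) := by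
  have h1 : ((i : ℕ) : ℝ) + 3 ≤ 2 * N := by
    have := i.2
    exact_mod_cast (show (i : ℕ) + 3 ≤ 2 * N by omega)
  have : 0 < (N : ℝ) - ((((i : ℕ) : ℝ) - 1) / 2 + 1) := by linarith
  positivity

lemma param_odd2 {N : ℕ} {β a b : ℝ} (hβ : 0 < β) (ha : 0 < a) (hb : 0 < b) (i : Fin (2 * N - 1))
    (hi : (i : ℕ) % 2 ≠ 0) :
    0 < β / 2 * ((N : ℝ) - ((((i : ℕ) : ℝ) - 1) / 2 + 1) - 1) + a + b := by
  have h1 : ((i : ℕ) : ℝ) + 3 ≤ 2 * N := by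
    have := i.2
    exact_mod_cast (show (i : ℕ) + 3 ≤ 2 * N by omega)
  have : 0 ≤ (N : ℝ) - ((((i : ℕ) : ℝ) - 1) / 2 + 1) - 1 := by linarith
  positivity

lemma betaMM_prob {N : ℕ} (hN : 0 < N) {β a b : ℝ} (hβ : 0 < β) (ha : 0 < a) (hb : 0 < b)
    (i : Fin (2 * N - 1)) : IsProbabilityMeasure (betaMM β a b N i) := by
  unfold betaMM
  split_ifs with h
  · exact betaM_prob (param_even hN hβ ha i) (param_even hN hβ hb i)
  · exact betaM_prob (param_odd1 hβ i h) (param_odd2 hβ ha hb i h)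

lemma betaK_pos {N : ℕ} (hN : 0 < N) {β a b : ℝ} (hβ : 0 < β) (ha : 0 < a) (hb : 0 < b)
    (i : Fin (2 * N - 1)) : 0 < betaK β a b N i := by
  unfold betaK
  split_ifs with h
  · have h1 := param_even hN hβ ha i
    have h2 := param_even hN hβ hb i
    exact div_pos (Real.Gamma_pos_of_pos (add_pos h1 h2))
      (mul_pos (Real.Gamma_pos_of_pos h1) (Real.Gamma_pos_of_pos h2))
  · have h1 := param_odd1 hβ i h
    have h2 := param_odd2 hβ ha hb i h
    exact div_pos (Real.Gamma_pos_of_pos (add_pos h1 h2))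
      (mul_pos (Real.Gamma_pos_of_pos h1) (Real.Gamma_pos_of_pos h2))

lemma measurable_betaD (β a b : ℝ) (N i : ℕ) : Measurable (betaD β a b N i) := by
  unfold betaD
  refine ENNReal.measurable_ofReal.comp (Measurable.indicator ?_ measurableSet_Ioo)
  refine measurable_const.mul ?_
  unfold powDens
  split_ifs <;> fun_prop

/-- The density on the cube. -/
def rho (β a b : ℝ) (N : ℕ) (c : Fin (2 * N - 1) → ℝ) : ℝ≥0∞ :=
  ENNReal.ofReal ((∏ i : Fin (2 * N - 1), betaK β a b N i) * ∏ i : Fin (2 * N - 1), powDens β a b N i (c i))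

lemma prod_betaD {N : ℕ} (hN : 0 < N) {β a b : ℝ} (hβ : 0 < β) (ha : 0 < a) (hb : 0 < b)
    (c : Fin (2 * N - 1) → ℝ) :
    ∏ i : Fin (2 * N - 1), betaD β a b N i (c i) = (cube (2 * N - 1)).indicator (rho β a b N) c := by
  by_cases hc : c ∈ cube (2 * N - 1)
  · rw [Set.indicator_of_mem hc, rho, ← Finset.prod_mul_distrib, ENNReal.ofReal_prod_of_nonneg]
    · exact Finset.prod_congr rfl fun i _ => by rw [betaD, Set.indicator_of_mem (hc i)]
    · exact fun i _ => (mul_pos (betaK_pos hN hβ ha hb i) (powDens_pos _ _ _ _ _ (hc i))).le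
  · rw [Set.indicator_of_notMem hc]
    simp only [cube, Set.mem_setOf_eq, not_forall] at hc
    obtain ⟨i, hi⟩ := hc
    refine Finset.prod_eq_zero (Finset.mem_univ i) ?_
    rw [betaD, Set.indicator_of_notMem hi, ENNReal.ofReal_zero]

/-- Eigenvalue map. -/
def eigT {N : ℕ} (c : Fin (2 * N - 1) → ℝ) : Fin N → ℝ :=
  jacobiEigs (xiToA (cToXi c)) (xiToB (cToXi c))

lemma measurableSet_cube_inter {N : ℕ} (hN : 0 < N) {A : Set (Fin N → ℝ)} (hA : MeasurableSet A) :
    MeasurableSet (cube (2 * N - 1) ∩ eigT ⁻¹' A) := by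
  have h1 : MeasurableSet (specDom N ∩ xs ⁻¹' A) :=
    (isOpen_specDom N).measurableSet.inter (continuous_xs.measurable hA)
  have h2 : MeasurableSet (momG '' (specDom N ∩ xs ⁻¹' A)) :=
    h1.image_of_continuousOn_injOn contDiff_momG.continuous.continuousOn
      ((injOn_momG hN).mono Set.inter_subset_left)
  have h3 : cube (2 * N - 1) ∩ eigT ⁻¹' A =
      cube (2 * N - 1) ∩ momF ⁻¹' (momG '' (specDom N ∩ xs ⁻¹' A)) := by
    ext c
    constructor
    · rintro ⟨hc, hcA⟩
      obtain ⟨p, hp, h1, h2, -⟩ := exists_spec hN hc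
      refine ⟨hc, p, ⟨hp, ?_⟩, h1⟩
      change xs p ∈ A
      rw [h2]; exact hcA
    · rintro ⟨hc, p, ⟨hp, hpA⟩, h⟩
      refine ⟨hc, ?_⟩
      have := (specRel_of hN hc hp h).2
      change eigT c ∈ A
      unfold eigT
      rw [← this]; exact hpA
  rw [h3]
  exact (isOpen_cube _).measurableSet.inter (contDiff_momF.continuous.measurable h2)

/-- Target density in `x`. -/
def hX (β a b : ℝ) {N : ℕ} (x : Fin N → ℝ) : ℝ :=
  |vdm x| ^ β * ∏ n : Fin N, (x n ^ (a - 1) * (1 - x n) ^ (b - 1))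

/-- Density in the weights. -/
def hW (β : ℝ) {N : ℕ} (y : Fin (N - 1) → ℝ) : ℝ≥0∞ :=
  {y : Fin (N - 1) → ℝ | ∀ i : Fin N, 0 < wfun y i}.indicator
    (fun y => ENNReal.ofReal (∏ n : Fin N, wfun y n ^ (β / 2 - 1))) y

lemma measurable_hW (β : ℝ) {N : ℕ} : Measurable (hW β : (Fin (N - 1) → ℝ) → ℝ≥0∞) := by
  unfold hW
  refine Measurable.indicator ?_ ?_
  · refine ENNReal.measurable_ofReal.comp (Finset.measurable_fun_prod _ fun i _ => ?_)
    exact (measurable_wfun i).pow_const _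
  · rw [Set.setOf_forall]
    exact MeasurableSet.iInter fun i => measurableSet_lt measurable_const (measurable_wfun i)

/-- Domain in `x`. -/
def domX (N : ℕ) : Set (Fin N → ℝ) := {x : Fin N → ℝ | x ∈ chamber N ∧ ∀ n, x n ∈ Set.Ioo (0 : ℝ) 1}

lemma measurableSet_domX (N : ℕ) : MeasurableSet (domX N) := by
  have : domX N = (⋂ i : Fin N, ⋂ j : Fin N, ⋂ _ : i < j, {x : Fin N → ℝ | x j < x i}) ∩
      ⋂ i : Fin N, {x | x i ∈ Set.Ioo (0 : ℝ) 1} := by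
    ext x; simp [domX, chamber]
  rw [this]
  refine MeasurableSet.inter ?_ ?_
  · exact MeasurableSet.iInter fun i => MeasurableSet.iInter fun j => MeasurableSet.iInter fun _ =>
      measurableSet_lt (measurable_pi_apply j) (measurable_pi_apply i)
  · exact MeasurableSet.iInter fun i => measurable_pi_apply i measurableSet_Ioo

lemma measurable_hX (β a b : ℝ) {N : ℕ} : Measurable (hX β a b : (Fin N → ℝ) → ℝ) := by
  unfold hX
  refine Measurable.mul ?_ ?_
  · exact (continuous_vdm.measurable.norm).pow_const _
  · refine Finset.measurable_fun_prod _ fun i _ => ?_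
    exact ((measurable_pi_apply i).pow_const _).mul ((measurable_const.sub (measurable_pi_apply i)).pow_const _)

lemma mem_specDom_iff {N : ℕ} (p : Fin (2 * N - 1) → ℝ) :
    p ∈ specDom N ↔ xs p ∈ domX N ∧ ys p ∈ {y : Fin (N - 1) → ℝ | ∀ i : Fin N, 0 < wfun y i} := by
  simp only [specDom, domX, chamber, Set.mem_setOf_eq, ws_eq, and_assoc]

lemma main_integral {N : ℕ} (hN : 2 ≤ N) {β a b : ℝ} (hβ : 0 < β) (ha : 0 < a) (hb : 0 < b)
    {A : Set (Fin N → ℝ)} (hA : MeasurableSet A) :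
    ∫⁻ c in cube (2 * N - 1), rho β a b N c * A.indicator 1 (eigT c) =
      (ENNReal.ofReal (∏ i : Fin (2 * N - 1), betaK β a b N i) * ∫⁻ y : Fin (N - 1) → ℝ, hW β y) *
      ∫⁻ x in A, ENNReal.ofReal ((domX N).indicator (hX β a b) x) := by
  have hN0 : 0 < N := by omega
  set K : ℝ := ∏ i : Fin (2 * N - 1), betaK β a b N i with hK
  have hKpos : 0 < K := Finset.prod_pos fun i _ => betaK_pos hN0 hβ ha hb i
  set P : (Fin (2 * N - 1) → ℝ) → ℝ := fun c => ∏ i : Fin (2 * N - 1), powDens β a b N i (c i) with hP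
  set k : (Fin (2 * N - 1) → ℝ) → ℝ≥0∞ := fun c =>
    ENNReal.ofReal (K * P c / jacF c) * A.indicator 1 (eigT c) with hk
  set Finv := Function.invFunOn (momF : (Fin (2 * N - 1) → ℝ) → _) (cube (2 * N - 1)) with hFinv
  have hinvc : ∀ c ∈ cube (2 * N - 1), Finv (momF c) = c := fun c hc =>
    injOn_momF.leftInvOn_invFunOn hc
  have s1 : ∫⁻ c in cube (2 * N - 1), rho β a b N c * A.indicator 1 (eigT c) =
      ∫⁻ z in momF '' cube (2 * N - 1), k (Finv z) := by
    rw [lintegral_image_eq_lintegral_abs_det_fderiv_mul volume (isOpen_cube _).measurableSet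
      (f' := fun c => fderiv ℝ momF c)
      (fun c _ => ((contDiff_momF.differentiable (by norm_num)) c).hasFDerivAt.hasFDerivWithinAt)
      injOn_momF]
    refine setLIntegral_congr_fun (isOpen_cube _).measurableSet fun c hc => ?_
    have hJ := jacF_pos hc
    simp only [hinvc c hc, det_fderiv_momF, hk]
    rw [← mul_assoc, ← ENNReal.ofReal_mul (abs_nonneg _), abs_of_pos hJ, mul_div_cancel₀ _ hJ.ne']
    rfl
  have s2 : ∫⁻ z in momG '' specDom N, k (Finv z) =
      ∫⁻ p in specDom N, ENNReal.ofReal K * (ENNReal.ofReal (hX β a b (xs p)) * A.indicator 1 (xs p) *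
        hW β (ys p)) := by
    rw [lintegral_image_eq_lintegral_abs_det_fderiv_mul volume (isOpen_specDom N).measurableSet
      (f' := fun p => fderiv ℝ momG p)
      (fun c _ => ((contDiff_momG.differentiable (by norm_num)) c).hasFDerivAt.hasFDerivWithinAt)
      (injOn_momG hN0)]
    refine setLIntegral_congr_fun (isOpen_specDom N).measurableSet fun p hp => ?_
    obtain ⟨c, hc, hcp⟩ : momG p ∈ momF '' cube (2 * N - 1) := by
      rw [image_eq hN]; exact ⟨p, hp, rfl⟩
    have hJ := jacF_pos hc
    obtain ⟨hrel, hx⟩ := specRel_of hN0 hc hp hcp.symm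
    have hden := density_identity hN0 β a b hc hp hrel
    have hmem := (mem_specDom_iff p).1 hp
    have hXnn : 0 ≤ hX β a b (xs p) := by
      refine mul_nonneg (Real.rpow_nonneg (abs_nonneg _) _) (Finset.prod_nonneg fun n _ => ?_)
      have := hmem.1.2 n
      exact mul_nonneg (Real.rpow_nonneg this.1.le _) (Real.rpow_nonneg (by linarith [this.2]) _)
    have hT : eigT c = xs p := hx.symm
    simp only [← hcp, hinvc c hc, hk, hT]
    rw [det_fderiv_momG hN0, hW, Set.indicator_of_mem hmem.2, ← ws_eq, ← mul_assoc,
      ← ENNReal.ofReal_mul (abs_nonneg _), mul_right_comm (ENNReal.ofReal (hX β a b (xs p))), ← mul_assoc,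
      ← ENNReal.ofReal_mul hXnn, ← ENNReal.ofReal_mul hKpos.le]
    congr 2
    change P c * _ = _ * (hX β a b (xs p) * _) at hden
    rw [mul_div_assoc', div_eq_iff hJ.ne']
    linear_combination K * hden
  rw [s1, image_eq hN, s2, lintegral_const_mul' _ _ ENNReal.ofReal_ne_top, mul_assoc]
  congr 1
  set Φ : (Fin N → ℝ) → ℝ≥0∞ := fun x => A.indicator (fun x => ENNReal.ofReal ((domX N).indicator (hX β a b) x)) x
    with hΦ
  have hΦm : Measurable Φ := Measurable.indicator
    (ENNReal.measurable_ofReal.comp ((measurable_hX β a b).indicator (measurableSet_domX N))) hA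
  rw [← lintegral_indicator hA, mul_comm (∫⁻ y, hW β y), ← lintegral_split hN0 hΦm (measurable_hW β),
    ← lintegral_indicator (isOpen_specDom N).measurableSet]
  refine lintegral_congr fun p => ?_
  by_cases hp : p ∈ specDom N
  · have hmem := (mem_specDom_iff p).1 hp
    rw [Set.indicator_of_mem hp]
    congr 1
    by_cases hxA : xs p ∈ A
    · simp only [hΦ, Set.indicator_of_mem hxA, Set.indicator_of_mem hmem.1, Pi.one_apply, mul_one]
    · simp only [hΦ, Set.indicator_of_notMem hxA, mul_zero]
  · rw [Set.indicator_of_notMem hp]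
    rw [mem_specDom_iff, not_and_or] at hp
    rcases hp with hp | hp
    · have : Φ (xs p) = 0 := by
        refine Set.indicator_apply_eq_zero.2 fun _ => ?_
        rw [Set.indicator_of_notMem hp, ENNReal.ofReal_zero]
      rw [this, zero_mul]
    · rw [hW, Set.indicator_of_notMem hp, mul_zero]

lemma main_aux (N : ℕ) (hN : 2 ≤ N) (β : ℝ) (hβ : 0 < β) (a b : ℝ) (ha : 0 < a) (hb : 0 < b) :
    ∃ C : ℝ≥0∞, C ≠ 0 ∧ C ≠ ⊤ ∧
      Measure.map (eigT (N := N)) (Measure.pi fun i : Fin (2 * N - 1) => betaMM β a b N i)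
        = C • (volume.withDensity fun x : Fin N → ℝ =>
            ENNReal.ofReal ((domX N).indicator (hX β a b) x)) := by
  have hN0 : 0 < N := by omega
  have hprob := betaMM_prob hN0 hβ ha hb
  set μ : Measure (Fin (2 * N - 1) → ℝ) := Measure.pi fun i : Fin (2 * N - 1) => betaMM β a b N i with hμ
  have hμp : IsProbabilityMeasure μ := by rw [hμ]; infer_instance
  have hμd : μ = volume.withDensity ((cube (2 * N - 1)).indicator (rho β a b N)) := by
    rw [hμ]
    have h1 := pi_withDensity (fun i : Fin (2 * N - 1) => betaD β a b N i)
      (fun i => measurable_betaD _ _ _ _ _) (fun i => by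
        rw [← betaMM_eq]; have := hprob i; infer_instance)
    simp only [← betaMM_eq] at h1
    rw [h1]
    congr 1
    ext c
    exact prod_betaD hN0 hβ ha hb c
  have hcm : MeasurableSet (cube (2 * N - 1)) := (isOpen_cube _).measurableSet
  have hμ0 : μ (cube (2 * N - 1))ᶜ = 0 := by
    rw [hμd, withDensity_apply _ hcm.compl]
    refine (setLIntegral_congr_fun (g := fun _ => 0) hcm.compl fun c hc => ?_).trans (by simp)
    exact Set.indicator_of_notMem hc _
  set T' : (Fin (2 * N - 1) → ℝ) → (Fin N → ℝ) := (cube (2 * N - 1)).indicator eigT with hT'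
  have hT'm : Measurable T' := by
    intro A hA
    have : T' ⁻¹' A = (cube (2 * N - 1) ∩ eigT ⁻¹' A) ∪ ((cube (2 * N - 1))ᶜ ∩ {_c | (0 : Fin N → ℝ) ∈ A}) := by
      ext c
      by_cases hc : c ∈ cube (2 * N - 1) <;> simp [hT', hc]
    rw [this]
    exact (measurableSet_cube_inter hN0 hA).union (hcm.compl.inter (MeasurableSet.const _))
  have hae : eigT =ᵐ[μ] T' := by
    have : ∀ᵐ c ∂μ, c ∈ cube (2 * N - 1) := by
      rw [ae_iff]; exact hμ0
    filter_upwards [this] with c hc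
    rw [hT', Set.indicator_of_mem hc]
  set C : ℝ≥0∞ := ENNReal.ofReal (∏ i : Fin (2 * N - 1), betaK β a b N i) * ∫⁻ y : Fin (N - 1) → ℝ, hW β y
    with hC
  set ν : Measure (Fin N → ℝ) := volume.withDensity fun x : Fin N → ℝ =>
            ENNReal.ofReal ((domX N).indicator (hX β a b) x) with hν
  have hmap : Measure.map (eigT (N := N)) μ = C • ν := by
    rw [Measure.map_congr hae]
    ext A hA
    rw [Measure.map_apply hT'm hA, Measure.smul_apply, hν, withDensity_apply _ hA, smul_eq_mul, hC,
      ← main_integral hN hβ ha hb hA, hμd, withDensity_apply _ (hT'm hA), ← lintegral_indicator (hT'm hA),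
      ← lintegral_indicator hcm]
    refine lintegral_congr fun c => ?_
    by_cases hc : c ∈ cube (2 * N - 1)
    · by_cases hA' : eigT c ∈ A
      · simp [Set.indicator_apply, hc, hA', hT']
      · simp [Set.indicator_apply, hc, hA', hT']
    · simp [Set.indicator_apply, hc]
  have htot : C * ν Set.univ = 1 := by
    have h1 : (Measure.map (eigT (N := N)) μ) Set.univ = 1 := by
      rw [Measure.map_congr hae, Measure.map_apply hT'm MeasurableSet.univ, Set.preimage_univ, measure_univ]
    rw [hmap, Measure.smul_apply, smul_eq_mul] at h1
    exact h1
  refine ⟨C, ?_, ?_, hmap⟩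
  · intro h
    rw [h, zero_mul] at htot
    exact zero_ne_one htot
  · intro h
    rw [h, ENNReal.top_mul'] at htot
    split_ifs at htot
    · exact zero_ne_one htot
    · exact ENNReal.top_ne_one htot

/-- tridiagonal model for the Jacobi β-ensemble. -/
theorem jacobi_beta_ensemble_tridiagonal
    (N : ℕ) (hN : 2 ≤ N) (β : ℝ) (hβ : 0 < β) (a b : ℝ) (ha : 0 < a) (hb : 0 < b) :
    ∃ C : ℝ≥0∞, C ≠ 0 ∧ C ≠ ⊤ ∧
      Measure.map
        (fun c : Fin (2 * N - 1) → ℝ => jacobiEigs (xiToA (cToXi c)) (xiToB (cToXi c)))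
        (Measure.pi fun i : Fin (2 * N - 1) =>
          if (i : ℕ) % 2 = 0 then
            betaM (β / 2 * ((N : ℝ) - (((i : ℕ) : ℝ) / 2 + 1)) + a)
                  (β / 2 * ((N : ℝ) - (((i : ℕ) : ℝ) / 2 + 1)) + b)
          else
            betaM (β / 2 * ((N : ℝ) - ((((i : ℕ) : ℝ) - 1) / 2 + 1)))
                  (β / 2 * ((N : ℝ) - ((((i : ℕ) : ℝ) - 1) / 2 + 1) - 1) + a + b))
        = C • (volume.withDensity fun x : Fin N → ℝ =>
            ENNReal.ofReal (Set.indicator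
              {x : Fin N → ℝ | x ∈ chamber N ∧ ∀ n, x n ∈ Set.Ioo (0 : ℝ) 1}
              (fun x => |vdm x| ^ β *
                ∏ n : Fin N, (x n ^ (a - 1) * (1 - x n) ^ (b - 1))) x)) := by
  exact main_aux N hN β hβ a b ha hb
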